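/- arXiv:0907.2097 — 2 statements merged into one kernel-verified Lean document; each statement's English description precedes it below -/
import Mathlib

section
/- Let C ⊂ 𝔸ⁿ be an affine algebraic curve defined over a number field K, S a finite set of places of K containing all infinite places, and O_S the ring of S-integers. Suppose C has exactly two points at infinity, both defined over K. If the set C(O_S) of S-integral points is infinite, then |S| ≥ 2. -/
open IsDedekindDomain NumberField

set_option synthInstance.maxHeartbeats 1000000
set_option maxHeartbeats 2000000

noncomputable section

/-- A place of a number field `K`: either an infinite (archimedean) place or a finite
place, i.e. a height-one prime of the ring of integers. -/
abbrev NFPlace (K : Type) [Field K] [NumberField K] :=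
  NumberField.InfinitePlace K ⊕ IsDedekindDomain.HeightOneSpectrum (NumberField.RingOfIntegers K)

variable (K : Type) [Field K] [NumberField K]

/-- The finite places belonging to a set `S` of places of `K`. -/
def finPart (S : Finset (NFPlace K)) : Set (HeightOneSpectrum (𝓞 K)) :=
  {v | Sum.inr v ∈ S}

/-- The ring of `S`-integers of `K` (as a subalgebra of `K`): the elements of `K` whose
valuation is at most one at every finite place outside `S`. -/
def SIntegers (S : Finset (NFPlace K)) : Subalgebra (𝓞 K) K :=
  (finPart K S).integer K

/-- A (geometrically integral) affine algebraic curve in `𝔸ⁿ` defined over `K`, given by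
an ideal of polynomials over `K` whose extension to the algebraic closure of `K` is prime
and cuts out a one-dimensional variety. -/
structure AffineCurve (n : ℕ) : Type where
  /-- The ideal of polynomials over `K` vanishing on the curve. -/
  J : Ideal (MvPolynomial (Fin n) K)
  /-- Geometric integrality: the extension of `J` to the algebraic closure is prime. -/
  hprime : (J.map (MvPolynomial.map (algebraMap K (AlgebraicClosure K)))).IsPrime
  /-- The curve is one-dimensional. -/
  hdim : ringKrullDim (MvPolynomial (Fin n) (AlgebraicClosure K) ⧸
      J.map (MvPolynomial.map (algebraMap K (AlgebraicClosure K)))) = 1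

namespace AffineCurve

variable {K} {n : ℕ} (C : AffineCurve K n)

/-- The ideal of the curve over the algebraic closure. -/
def idealBar : Ideal (MvPolynomial (Fin n) (AlgebraicClosure K)) :=
  C.J.map (MvPolynomial.map (algebraMap K (AlgebraicClosure K)))

instance : C.idealBar.IsPrime := C.hprime

/-- The coordinate ring of the curve over the algebraic closure. -/
abbrev CoordRing := MvPolynomial (Fin n) (AlgebraicClosure K) ⧸ C.idealBar

/-- The function field `K̄(C)` of the curve over the algebraic closure of `K`. -/
abbrev FunField := FractionRing C.CoordRing

/-- The coordinate functions `x₁, …, xₙ`, as elements of the function field. -/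
def xcoord (i : Fin n) : C.FunField :=
  algebraMap C.CoordRing C.FunField (Ideal.Quotient.mk C.idealBar (MvPolynomial.X i))

/-- The embedding of the constants `K̄` into the function field. -/
def constMap : AlgebraicClosure K →+* C.FunField :=
  ((algebraMap C.CoordRing C.FunField) : C.CoordRing →+* C.FunField).comp
    ((Ideal.Quotient.mk C.idealBar).comp MvPolynomial.C)

/-- The embedding of `K` into the function field. -/
def constMapK : K →+* C.FunField := C.constMap.comp (algebraMap K (AlgebraicClosure K))

/-- A place of the curve: a nontrivial valuation subring of `K̄(C)` containing the
constants `K̄`. -/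
def IsPlace (V : ValuationSubring C.FunField) : Prop :=
  (∀ a : AlgebraicClosure K, C.constMap a ∈ V) ∧ V ≠ ⊤

/-- A point at infinity of the curve: a place of `K̄(C)` at which at least one of the
coordinate functions admits a pole. -/
def IsPointAtInfinity (V : ValuationSubring C.FunField) : Prop :=
  C.IsPlace V ∧ ∃ i, C.xcoord i ∉ V

/-- The curve has genus `0`: equivalently (the field of constants `K̄` being algebraically
closed), its function field is a rational function field `K̄(t)`. -/
def GenusZero : Prop :=
  ∃ t : C.FunField, Subfield.closure (Set.range C.constMap ∪ {t}) = ⊤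

/-- `σ` is an automorphism of `K̄(C)` over `K(C) = K(x₁, …, xₙ)`. -/
def FixesKC (σ : C.FunField ≃+* C.FunField) : Prop :=
  (∀ a : K, σ (C.constMapK a) = C.constMapK a) ∧ ∀ i, σ (C.xcoord i) = C.xcoord i

/-- A place of `K̄(C)` is defined over `K` if it is fixed by every automorphism of
`K̄(C)` over `K(C)`. -/
def DefinedOverK (V : ValuationSubring C.FunField) : Prop :=
  ∀ σ : C.FunField ≃+* C.FunField, C.FixesKC σ → V.comap σ.toRingHom = V

/-- Two places of `K̄(C)` are conjugate over `K` if some automorphism of `K̄(C)` over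
`K(C)` interchanges them. -/
def ConjugateOverK (A B : ValuationSubring C.FunField) : Prop :=
  ∃ σ : C.FunField ≃+* C.FunField, C.FixesKC σ ∧
    A.comap σ.toRingHom = B ∧ B.comap σ.toRingHom = A

/-- `σ` is an automorphism of `K̄(C)` over `L(C)`, for an intermediate field
`K ⊆ L ⊆ K̄`. -/
def FixesLC (L : IntermediateField K (AlgebraicClosure K)) (σ : C.FunField ≃+* C.FunField) :
    Prop :=
  (∀ a : L, σ (C.constMap a) = C.constMap a) ∧ ∀ i, σ (C.xcoord i) = C.xcoord i

/-- A place of `K̄(C)` is defined over `L` if it is fixed by every automorphism of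
`K̄(C)` over `L(C)`. -/
def DefinedOver (L : IntermediateField K (AlgebraicClosure K))
    (V : ValuationSubring C.FunField) : Prop :=
  ∀ σ : C.FunField ≃+* C.FunField, C.FixesLC L σ → V.comap σ.toRingHom = V

/-- `P` is a `K`-rational point of the curve. -/
def OnCurve (P : Fin n → K) : Prop := ∀ f ∈ C.J, MvPolynomial.eval P f = 0

/-- The set `C(O_S)` of `S`-integral points of the curve: the `K`-rational points all of
whose coordinates are `S`-integers. -/
def SIntegralPoints (S : Finset (NFPlace K)) : Set (Fin n → K) :=
  {P | C.OnCurve P ∧ ∀ i, P i ∈ SIntegers K S}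

/-- `P` is a non-singular point of the curve: `P` lies on the curve and the gradients at
`P` of the polynomials vanishing on the curve span a space of dimension `n - 1`
(Jacobian criterion for a one-dimensional variety). -/
def IsNonsingularPoint (P : Fin n → K) : Prop :=
  C.OnCurve P ∧ Module.finrank K (Submodule.span K
    {g : Fin n → K | ∃ f ∈ C.J, g = fun i => MvPolynomial.eval P (MvPolynomial.pderiv i f)}) =
      n - 1

end AffineCurve

section FunctionFieldPlaces

open Polynomial IntermediateField
open scoped IntermediateField.algebraAdjoinAdjoin

namespace ValuationSubring

variable {k F : Type*} [Field k] [Field F] [Algebra k F]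

/-- A valuation subring contains every element integral over a ring mapping into it. -/
lemma mem_of_isIntegral_algebraMap {R : Type*} [CommRing R] [Algebra R F] {V : ValuationSubring F}
    (hV : ∀ r : R, algebraMap R F r ∈ V) {y : F} (hy : IsIntegral R y) : y ∈ V := by
  let _ : Algebra R V := ((algebraMap R F).codRestrict V hV).toAlgebra
  have : IsScalarTower R V F := IsScalarTower.of_algebraMap_eq fun _ => rfl
  obtain ⟨z, hz⟩ := IsIntegrallyClosed.isIntegral_iff.mp (hy.tower_top (A := V))
  exact hz ▸ z.2

/-- A valuation subring containing a field `k` has trivial valuation on `k`. -/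
lemma isTrivialOn_valuation {V : ValuationSubring F} (hV : ∀ a : k, algebraMap k F a ∈ V) :
    V.valuation.IsTrivialOn k where
  eq_one a ha := by
    refine le_antisymm ((V.valuation_le_one_iff _).mpr (hV a)) ?_
    have h := (V.valuation_le_one_iff _).mpr (hV a⁻¹)
    rw [map_inv₀, map_inv₀] at h
    exact (inv_le_one₀ (zero_lt_iff.mpr (by simpa using ha))).mp h

lemma one_lt_valuation_of_notMem {V : ValuationSubring F} {x : F} (hx : x ∉ V) :
    1 < V.valuation x :=
  lt_of_not_ge fun h => hx ((V.valuation_le_one_iff x).mp h)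

lemma valuation_aeval_of_notMem {V : ValuationSubring F} (hV : ∀ a : k, algebraMap k F a ∈ V)
    {x : F} (hx : x ∉ V) {p : k[X]} (hp : p ≠ 0) :
    V.valuation (aeval x p) = V.valuation x ^ p.natDegree :=
  have := isTrivialOn_valuation hV
  valuation_aeval_eq_valuation_X_pow_natDegree_of_one_lt_valuation_X x
    (one_lt_valuation_of_notMem hx) hp

lemma transcendental_of_notMem {V : ValuationSubring F} (hV : ∀ a : k, algebraMap k F a ∈ V)
    {x : F} (hx : x ∉ V) : Transcendental k x :=
  fun h => hx (mem_of_isIntegral_algebraMap hV h.isIntegral)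

lemma aeval_mem {V : ValuationSubring F} (hV : ∀ a : k, algebraMap k F a ∈ V)
    {x : F} (hx : x ∈ V) (p : k[X]) : aeval x p ∈ V := by
  rw [aeval_eq_sum_range]
  refine sum_mem fun i _ => ?_
  rw [Algebra.smul_def]
  exact MulMemClass.mul_mem (hV _) (pow_mem hx i)

lemma adjoin_singleton_algebraMap_mem {V : ValuationSubring F}
    (hV : ∀ a : k, algebraMap k F a ∈ V) {x : F} (hx : x ∈ V) (r : Algebra.adjoin k {x}) :
    algebraMap (Algebra.adjoin k {x}) F r ∈ V := by
  obtain ⟨r, hr⟩ := r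
  rw [Algebra.adjoin_singleton_eq_range_aeval] at hr
  obtain ⟨p, rfl⟩ := hr
  exact aeval_mem hV hx p

lemma aeval_div_aeval_mem {V : ValuationSubring F} (hV : ∀ a : k, algebraMap k F a ∈ V)
    {x : F} (hx : x ∉ V) {p q : k[X]} (hq : q ≠ 0) (hpq : p.natDegree ≤ q.natDegree) :
    aeval x p / aeval x q ∈ V := by
  rcases eq_or_ne p 0 with rfl | hp
  · simp
  have h1 := one_lt_valuation_of_notMem hx
  rw [← V.valuation_le_one_iff, map_div₀, valuation_aeval_of_notMem hV hx hp,
    valuation_aeval_of_notMem hV hx hq]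
  exact div_le_one_of_le₀ (pow_le_pow_right₀ h1.le hpq) zero_le

/-- In a function field of transcendence degree at most one, the nontrivial valuation subrings
over the constants are pairwise incomparable. -/
lemma eq_of_le_of_isAlgebraic_adjoin
    (htr : ∀ x : F, Transcendental k x → Algebra.IsAlgebraic (Algebra.adjoin k {x}) F)
    {A B : ValuationSubring F} (hA : ∀ a : k, algebraMap k F a ∈ A) (hAB : A ≤ B)
    (hB : B ≠ ⊤) : A = B := by
  by_contra hne
  obtain ⟨b, hbB, hbA⟩ := Set.exists_of_ssubset ((lt_of_le_of_ne hAB hne : A < B) : (A : Set F) ⊂ B)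
  have hkB : ∀ a : k, algebraMap k F a ∈ B := fun a => hAB (hA a)
  have hinv : ∀ q : k[X], (aeval b q)⁻¹ ∈ B := by
    intro q
    rcases eq_or_ne q 0 with rfl | hq
    · simp
    refine hAB ?_
    simpa using aeval_div_aeval_mem (p := 1) hA hbA hq (by simp)
  have hfield : ∀ r : k⟮b⟯, algebraMap k⟮b⟯ F r ∈ B := by
    rintro ⟨r, hr⟩
    obtain ⟨p, q, rfl⟩ := (mem_adjoin_simple_iff k r).mp hr
    change aeval b p / aeval b q ∈ B
    rw [div_eq_mul_inv]
    exact MulMemClass.mul_mem (aeval_mem hkB hbB p) (hinv q)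
  have := htr b (transcendental_of_notMem hA hbA)
  have : Algebra.IsAlgebraic k⟮b⟯ F :=
    Algebra.IsAlgebraic.extendScalars (R := Algebra.adjoin k {b})
      (FaithfulSMul.algebraMap_injective _ _)
  refine hB (top_unique fun y _ => ?_)
  exact mem_of_isIntegral_algebraMap hfield (Algebra.IsIntegral.isIntegral (R := k⟮b⟯) y)

end ValuationSubring

open ValuationSubring (mem_of_isIntegral_algebraMap one_lt_valuation_of_notMem
  valuation_aeval_of_notMem transcendental_of_notMem aeval_mem adjoin_singleton_algebraMap_mem
  aeval_div_aeval_mem)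

variable {k F : Type*} [Field k] [Field F] [Algebra k F]

variable (k) in
/-- The functions regular at all places over `k` satisfying `P`. -/
def regularAt (P : ValuationSubring F → Prop) : Submodule k F where
  carrier := {f | ∀ V : ValuationSubring F, (∀ a : k, algebraMap k F a ∈ V) → P V → f ∈ V}
  add_mem' hf hg V hV hP := add_mem (hf V hV hP) (hg V hV hP)
  zero_mem' V _ _ := zero_mem V
  smul_mem' c f hf V hV hP := by
    rw [Algebra.smul_def]
    exact mul_mem (hV c) (hf V hV hP)

/-- Every `k(x)`-line in the function field is, up to finite dimension over `k`, a sum of functions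
regular where `x` is regular and functions regular at the poles of `x`. -/
lemma exists_finite_mul_mem_regularAt_sup
    (htr : ∀ x : F, Transcendental k x → Algebra.IsAlgebraic (Algebra.adjoin k {x}) F)
    {x : F} (hx : Transcendental k x) (y : F) :
    ∃ W : Submodule k F, Module.Finite k W ∧
      ∀ a ∈ k⟮x⟯, a * y ∈ regularAt k (x ∈ ·) ⊔ regularAt k (x ∉ ·) ⊔ W := by
  have hx0 : x ≠ 0 := by
    rintro rfl
    exact hx (isAlgebraic_zero)
  have hne : ∀ {p : k[X]}, p ≠ 0 → aeval x p ≠ 0 := fun hp h => hx ⟨_, hp, h⟩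
  obtain ⟨q, hq, hqint⟩ : ∃ q : k[X], q ≠ 0 ∧ aeval x q * y ∈ regularAt k (x ∈ ·) := by
    have := htr x hx
    obtain ⟨⟨r, hr⟩, hr0, h_integral⟩ :=
      (Algebra.IsAlgebraic.isAlgebraic (R := Algebra.adjoin k {x}) y).exists_integral_multiple
    have hr' := hr
    rw [Algebra.adjoin_singleton_eq_range_aeval] at hr'
    obtain ⟨q, rfl⟩ := hr'
    refine ⟨q, ?_, fun V hV hxV =>
      mem_of_isIntegral_algebraMap (adjoin_singleton_algebraMap_mem hV hxV) h_integral⟩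
    rintro rfl
    exact hr0 (Subtype.ext (by simp))
  set y₀ := aeval x q * y with hy₀
  obtain ⟨c, hc⟩ : ∃ c : ℕ, x⁻¹ ^ c * y₀ ∈ regularAt k (x ∉ ·) := by
    have hxinv : Transcendental k x⁻¹ := fun h => hx (IsAlgebraic.inv_iff.mp h)
    have := htr _ hxinv
    obtain ⟨⟨r, hr⟩, hr0, h_integral⟩ :=
      (Algebra.IsAlgebraic.isAlgebraic (R := Algebra.adjoin k {x⁻¹}) y₀).exists_integral_multiple
    have hr' := hr
    rw [Algebra.adjoin_singleton_eq_range_aeval] at hr'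
    obtain ⟨p, rfl⟩ := hr'
    have hp : p ≠ 0 := by
      rintro rfl
      exact hr0 (Subtype.ext (by simp))
    refine ⟨p.natDegree, fun V hV hxV => ?_⟩
    have hxV' : x⁻¹ ∈ V := (V.mem_or_inv_mem x).resolve_left hxV
    have h1 : aeval x⁻¹ p * y₀ ∈ V :=
      mem_of_isIntegral_algebraMap (adjoin_singleton_algebraMap_mem hV hxV') h_integral
    have hrev0 : p.reverse ≠ 0 := by simpa using hp
    have h2 : (aeval x p.reverse)⁻¹ ∈ V := by
      simpa using aeval_div_aeval_mem (p := 1) hV hxV hrev0 (by simp)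
    let _ : Invertible x⁻¹ := invertibleOfNonzero (inv_ne_zero hx0)
    have h3 : aeval x p.reverse * x⁻¹ ^ p.natDegree = aeval x⁻¹ p := by
      have := eval₂_reverse_mul_pow (algebraMap k F) x⁻¹ p
      simpa [aeval_def] using this
    have h4 : x⁻¹ ^ p.natDegree * y₀ = (aeval x p.reverse)⁻¹ * (aeval x⁻¹ p * y₀) := by
      rw [← h3]
      field_simp [hne hrev0]
    rw [h4]
    exact mul_mem h2 h1
  let φ : k[X] →ₗ[k] F :=
    (LinearMap.mulRight k (x⁻¹ ^ c * y₀)).comp (aeval x).toLinearMap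
  refine ⟨(degreeLT k c).map φ, inferInstance, fun a ha => ?_⟩
  have ha' : x ^ c * (a / aeval x q) ∈ k⟮x⟯ :=
    mul_mem (pow_mem (mem_adjoin_simple_self k x) c)
      (div_mem ha (algebra_adjoin_le_adjoin k _ (aeval_mem_adjoin_singleton k x)))
  obtain ⟨N, D, hND⟩ := (mem_adjoin_simple_iff k _).mp ha'
  have hay : a * y = aeval x N / aeval x D * (x⁻¹ ^ c * y₀) := by
    rw [← hND, hy₀, inv_pow]
    field_simp [hne hq]
  rcases eq_or_ne D 0 with rfl | hD
  · rw [hay]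
    simp
  have hNs : N = D * (X ^ c * ((N / D) /ₘ X ^ c) + (N / D) %ₘ X ^ c) + N % D := by
    rw [add_comm (X ^ c * _), modByMonic_add_div]
    exact (EuclideanDomain.div_add_mod N D).symm
  have hsplit : a * y = aeval x ((N / D) /ₘ X ^ c) * y₀
      + aeval x (N % D) / aeval x D * (x⁻¹ ^ c * y₀) + φ ((N / D) %ₘ X ^ c) := by
    rw [hay]
    nth_rewrite 1 [hNs]
    simp only [map_add, map_mul, map_pow, aeval_X, φ, inv_pow,
      LinearMap.comp_apply, LinearMap.mulRight_apply, AlgHom.toLinearMap_apply]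
    field_simp [hne hD]
    ring
  rw [hsplit]
  refine Submodule.add_mem_sup (Submodule.add_mem_sup ?_ ?_) ?_
  · exact fun V hV hxV => mul_mem (aeval_mem hV hxV _) (hqint V hV hxV)
  · exact fun V hV hxV => mul_mem
      (aeval_div_aeval_mem hV hxV hD (natDegree_le_natDegree (degree_mod_lt N hD).le)) (hc V hV hxV)
  · refine Submodule.mem_map_of_mem (mem_degreeLT.mpr ?_)
    exact (degree_modByMonic_lt _ (monic_X_pow c)).trans_eq (degree_X_pow c)

/-- Some nonconstant polynomial in `t` without constant term is a sum of a function regular where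
`x` is regular and a function regular at the poles of `x`. -/
lemma exists_aeval_X_mul_mem_regularAt_sup
    (htr : ∀ x : F, Transcendental k x → Algebra.IsAlgebraic (Algebra.adjoin k {x}) F)
    {x : F} (hx : Transcendental k x) (t : F) :
    ∃ p : k[X], p ≠ 0 ∧
      aeval t (X * p) ∈ regularAt k (x ∈ ·) ⊔ regularAt k (x ∉ ·) := by
  set Q := regularAt k (F := F) (x ∈ ·) ⊔ regularAt k (x ∉ ·) with hQ
  have := htr x hx
  have : Algebra.IsAlgebraic k⟮x⟯ F :=
    Algebra.IsAlgebraic.extendScalars (R := Algebra.adjoin k {x})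
      (FaithfulSMul.algebraMap_injective _ _)
  obtain ⟨s, hs⟩ := (Algebra.IsIntegral.isIntegral (R := k⟮x⟯) t).fg_adjoin_singleton
  choose W hWfin hW using exists_finite_mul_mem_regularAt_sup htr hx
  let T : Submodule k F := ⨆ y : s, W y
  have hpow : ∀ p : k[X], aeval t p ∈ Q ⊔ T := by
    intro p
    have hmem : aeval t p ∈ Submodule.span k⟮x⟯ (s : Set F) := by
      rw [hs]
      have h1 : aeval t p = aeval t (p.map (algebraMap k k⟮x⟯)) := by simp
      rw [h1]
      exact aeval_mem_adjoin_singleton _ _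
    obtain ⟨f, -, hf⟩ := Submodule.mem_span_finset.mp hmem
    rw [← hf]
    refine sum_mem fun y hy => ?_
    have h2 := hW y (f y) (f y).2
    exact sup_le_sup_left (le_iSup (fun y : s => W y) ⟨y, hy⟩) Q h2
  let ψ : k[X] →ₗ[k] F ⧸ Q :=
    Q.mkQ.comp ((aeval t).toLinearMap.comp (LinearMap.mulLeft k X))
  have hTfin : Module.Finite k (T.map Q.mkQ) := inferInstance
  have hrange : ∀ p, ψ p ∈ T.map Q.mkQ := by
    intro p
    obtain ⟨u, hu, w, hw, huw⟩ := Submodule.mem_sup.mp (hpow (X * p))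
    refine ⟨w, hw, ?_⟩
    have : ψ p = Q.mkQ (u + w) := by rw [huw]; rfl
    rw [this, map_add, (Submodule.Quotient.mk_eq_zero Q).mpr hu |> (fun h => (h : Q.mkQ u = 0)),
      zero_add]
  by_contra hcon
  push Not at hcon
  have hinj : Function.Injective (ψ.codRestrict _ hrange) := by
    rw [← LinearMap.ker_eq_bot, LinearMap.ker_eq_bot']
    intro p hp
    by_contra hp0
    refine hcon p hp0 ((Submodule.Quotient.mk_eq_zero Q).mp ?_)
    exact congrArg Subtype.val hp
  have := Module.Finite.of_injective _ hinj
  exact Polynomial.not_finite this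

/-- Existence of a function whose only pole is the place `A`, provided that `A` and `B` are the only
possible poles of some function `x` having a pole at `A`. -/
lemma exists_pole_only_at
    (htr : ∀ x : F, Transcendental k x → Algebra.IsAlgebraic (Algebra.adjoin k {x}) F)
    {A B : ValuationSubring F} (hA : ∀ a : k, algebraMap k F a ∈ A)
    (hBA : ¬ B ≤ A) {x : F} (hx : x ∉ A)
    (hpoles : ∀ V : ValuationSubring F, (∀ a : k, algebraMap k F a ∈ V) → x ∉ V →
      V = A ∨ V = B) :
    ∃ f : F, f ∉ A ∧
      ∀ V : ValuationSubring F, (∀ a : k, algebraMap k F a ∈ V) → V ≠ A → f ∈ V := by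
  obtain ⟨t, htB, htA⟩ := Set.not_subset.mp hBA
  obtain ⟨p, hp, hmem⟩ :=
    exists_aeval_X_mul_mem_regularAt_sup htr (transcendental_of_notMem hA hx) t
  obtain ⟨f, hf, g, hg, hfg⟩ := Submodule.mem_sup.mp hmem
  have hf' : f = aeval t (X * p) - g := by rw [← hfg]; ring
  refine ⟨f, fun hfA => ?_, fun V hV hVA => ?_⟩
  · have h1 : aeval t (X * p) ∈ A := hfg ▸ add_mem hfA (hg A hA hx)
    have h2 : t * aeval t p ∈ A := by simpa using h1
    have h3 := (A.valuation_le_one_iff _).mpr h1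
    rw [valuation_aeval_of_notMem hA htA (mul_ne_zero X_ne_zero hp), natDegree_X_mul hp] at h3
    exact absurd h3 (not_le.mpr (one_lt_pow₀ (one_lt_valuation_of_notMem htA) (by simp)))
  · by_cases hxV : x ∈ V
    · exact hf V hV hxV
    · obtain rfl := (hpoles V hV hxV).resolve_left hVA
      rw [hf']
      exact sub_mem (aeval_mem hV htB _) (hg V hV hxV)

/-- If no place over `k` is a common pole of `f` and `g`, then `1` is a polynomial without constant
term in `f⁻¹` and `g⁻¹`. -/
lemma exists_aeval_inv_eq_one {f g : F}
    (hfg : ∀ V : ValuationSubring F, (∀ a : k, algebraMap k F a ∈ V) → f ∈ V ∨ g ∈ V)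
    (hf : f ≠ 0) (hg : g ≠ 0) :
    ∃ p : MvPolynomial (Fin 2) k, MvPolynomial.constantCoeff p = 0 ∧
      MvPolynomial.aeval ![f⁻¹, g⁻¹] p = 1 := by
  let T := (MvPolynomial.aeval (R := k) ![f⁻¹, g⁻¹]).range
  let ρ : MvPolynomial (Fin 2) k →ₐ[k] T :=
    (MvPolynomial.aeval (R := k) ![f⁻¹, g⁻¹]).rangeRestrict
  let I : Ideal T := Ideal.span {ρ (MvPolynomial.X 0), ρ (MvPolynomial.X 1)}
  have hI : I = ⊤ := by
    by_contra hne
    obtain ⟨V, hTV, hIV⟩ := Ideal.image_subset_nonunits_valuationSubring (A := T.toSubring) I hne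
    have h0 : f⁻¹ ∈ V.nonunits := hIV ⟨ρ (MvPolynomial.X 0),
      Ideal.subset_span (by simp), by change MvPolynomial.aeval _ _ = _; simp⟩
    have h1 : g⁻¹ ∈ V.nonunits := hIV ⟨ρ (MvPolynomial.X 1),
      Ideal.subset_span (by simp), by change MvPolynomial.aeval _ _ = _; simp⟩
    rcases hfg V (fun a => hTV (T.algebraMap_mem a)) with h | h
    · exact ((V.inv_mem_nonunits_iff.mp h0).resolve_left hf) h
    · exact ((V.inv_mem_nonunits_iff.mp h1).resolve_left hg) h
  obtain ⟨a, b, hab⟩ := Ideal.mem_span_pair.mp ((Ideal.eq_top_iff_one I).mp hI)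
  obtain ⟨p, rfl⟩ := AlgHom.rangeRestrict_surjective _ a
  obtain ⟨q, rfl⟩ := AlgHom.rangeRestrict_surjective _ b
  refine ⟨p * MvPolynomial.X 0 + q * MvPolynomial.X 1, by simp, ?_⟩
  simpa [ρ] using congrArg T.val hab

end FunctionFieldPlaces

section CurveAlgebra

/-- A polynomial ring of Krull dimension at most one over a field has at most one variable. -/
lemma MvPolynomial.le_one_of_krullDimLE_one {k : Type*} [Field k] {s : ℕ}
    (h : ∀ P : Ideal (MvPolynomial (Fin s) k), P.IsPrime → P ≠ ⊥ → P.IsMaximal) : s ≤ 1 := by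
  by_contra! hs
  obtain ⟨m, rfl⟩ : ∃ m, s = m + 2 := ⟨s - 2, by omega⟩
  let φ : MvPolynomial (Fin (m + 2)) k →ₐ[k] Polynomial k :=
    MvPolynomial.aeval (fun i => if i = 0 then 0 else Polynomial.X)
  have hφ : Function.Surjective φ := by
    rw [← AlgHom.range_eq_top, eq_top_iff, ← Polynomial.adjoin_X, Algebra.adjoin_le_iff]
    rintro _ rfl
    exact ⟨MvPolynomial.X 1, by simp [φ]⟩
  have hne : RingHom.ker φ ≠ ⊥ := by
    intro hbot
    have h0 : (MvPolynomial.X 0 : MvPolynomial (Fin (m + 2)) k) ∈ RingHom.ker φ := by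
      simp [RingHom.mem_ker, φ]
    rw [hbot, Ideal.mem_bot] at h0
    exact MvPolynomial.X_ne_zero _ h0
  have hmax := h _ (RingHom.ker_isPrime φ) hne
  have hfield : IsField (MvPolynomial (Fin (m + 2)) k ⧸ RingHom.ker φ) :=
    (Ideal.Quotient.maximal_ideal_iff_isField_quotient _).mp hmax
  exact Polynomial.not_isField k
    ((Ideal.quotientKerAlgEquivOfSurjective hφ).symm.toMulEquiv.isField hfield)

/-- The fraction field of a finitely generated domain of Krull dimension at most one has
transcendence degree at most one. -/
lemma isAlgebraic_adjoin_of_krullDimLE_one {k R F : Type*} [Field k] [CommRing R] [IsDomain R]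
    [Algebra k R] [Algebra.FiniteType k R] [Ring.KrullDimLE 1 R] [Field F] [Algebra R F]
    [IsFractionRing R F] [Algebra k F] [IsScalarTower k R F] {x : F} (hx : Transcendental k x) :
    Algebra.IsAlgebraic (Algebra.adjoin k {x}) F := by
  obtain ⟨s, g, hginj, hgint⟩ := exists_integral_inj_algHom_of_fg k R
  have hs : s ≤ 1 := by
    refine MvPolynomial.le_one_of_krullDimLE_one (k := k) fun P hP hP0 => ?_
    let _ := g.toRingHom.toAlgebra
    have : Algebra.IsIntegral (MvPolynomial (Fin s) k) R := ⟨hgint⟩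
    obtain ⟨Q, hQ, hQP⟩ := Ideal.exists_ideal_over_prime_of_isIntegral_of_isDomain
      (S := R) P (by
        rw [show RingHom.ker (algebraMap (MvPolynomial (Fin s) k) R) = ⊥ from
          (RingHom.injective_iff_ker_eq_bot _).mp hginj]
        exact bot_le)
    have hQ0 : Q ≠ ⊥ := by
      rintro rfl
      refine hP0 (hQP ▸ ?_)
      exact (RingHom.injective_iff_ker_eq_bot _).mp hginj
    have := Ring.krullDimLE_one_iff_of_noZeroDivisors.mp ‹_› Q hQ0 hQ
    rw [← hQP]
    exact Ideal.isMaximal_comap_of_isIntegral_of_isMaximal Q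
  let y : Fin s → F := fun i => algebraMap R F (g (MvPolynomial.X i))
  have hy : ∀ p, MvPolynomial.aeval y p = algebraMap R F (g p) := fun p => by
    have : MvPolynomial.aeval y = (IsScalarTower.toAlgHom k R F).comp g :=
      MvPolynomial.algHom_ext fun i => by simp [y]
    rw [this]
    rfl
  have halg : Algebra.IsAlgebraic (Algebra.adjoin k (Set.range y)) F := by
    have hR : ∀ r : R, IsAlgebraic (Algebra.adjoin k (Set.range y)) (algebraMap R F r) := by
      intro r
      obtain ⟨p, hp, hpr⟩ := hgint r
      let ρ : MvPolynomial (Fin s) k →+* Algebra.adjoin k (Set.range y) :=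
        (MvPolynomial.aeval y).toRingHom.codRestrict _ fun p => by
          rw [Algebra.adjoin_range_eq_range_aeval]
          exact ⟨p, rfl⟩
      refine IsIntegral.isAlgebraic ⟨p.map ρ, hp.map ρ, ?_⟩
      rw [Polynomial.eval₂_map]
      have hcomp : (algebraMap (Algebra.adjoin k (Set.range y)) F).comp ρ =
          (algebraMap R F).comp g.toRingHom := RingHom.ext fun p => hy p
      have := congrArg (algebraMap R F) hpr
      rw [Polynomial.hom_eval₂, map_zero] at this
      rwa [hcomp]
    refine ⟨fun z => ?_⟩
    obtain ⟨a, b, -, rfl⟩ := IsFractionRing.div_surjective R z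
    rw [div_eq_mul_inv]
    exact (hR a).mul (hR b).inv
  have htrdeg : Algebra.trdeg k F ≤ 1 := by
    refine (Algebra.IsAlgebraic.trdeg_le_cardinalMk k (Set.range y)).trans ?_
    refine Cardinal.mk_le_one_iff_set_subsingleton.mpr ?_
    have : Subsingleton (Fin s) := Fin.subsingleton_iff_le_one.mpr hs
    rintro _ ⟨i, rfl⟩ _ ⟨j, rfl⟩
    rw [Subsingleton.elim i j]
  have hind : AlgebraicIndependent k (fun _ : Unit => x) :=
    algebraicIndependent_unique_type_iff.mpr hx
  have hbasis := hind.isTranscendenceBasis_of_lift_trdeg_le_of_finite (by simpa using htrdeg)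
  have := hbasis.isAlgebraic
  rwa [Set.range_const] at this

/-- In a Noetherian domain of Krull dimension at most one, a nonzero element lies in finitely many
maximal ideals. -/
lemma finite_setOf_isMaximal_mem {R : Type*} [CommRing R] [IsDomain R] [IsNoetherianRing R]
    [Ring.KrullDimLE 1 R] {s : R} (hs : s ≠ 0) : {M : Ideal R | M.IsMaximal ∧ s ∈ M}.Finite := by
  refine (Ideal.finite_minimalPrimes_of_isNoetherianRing R (Ideal.span {s})).subset ?_
  rintro M ⟨hM, hsM⟩
  obtain ⟨P, hP, hPM⟩ := Ideal.exists_minimalPrimes_le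
    (show Ideal.span {s} ≤ M from (Ideal.span_singleton_le_iff_mem M).mpr hsM)
  have hsP : s ∈ P := hP.1.2 (Ideal.mem_span_singleton_self s)
  have hP0 : P ≠ ⊥ := by
    rintro rfl
    exact hs ((Ideal.mem_bot).mp hsP)
  have hPmax := Ring.krullDimLE_one_iff_of_noZeroDivisors.mp ‹_› P hP0 hP.1.1
  rwa [← hPmax.eq_of_le hM.ne_top hPM]

/-- Descent of a function whose only pole is `A` along a normal extension all of whose automorphisms
fix `A`, by taking the norm. -/
lemma exists_pole_only_at_of_normal {K k F : Type*} [Field K] [Field k] [Field F] [Algebra K k]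
    [Algebra k F] [Algebra K F] [IsScalarTower K k F] [Algebra.IsAlgebraic K k]
    (E : IntermediateField K F) [Normal E F] {A : ValuationSubring F}
    (hA : ∀ σ : F ≃ₐ[E] F, A.comap (σ : F →+* F) = A) {f : F} (hfA : f ∉ A)
    (hf : ∀ V : ValuationSubring F, (∀ a : k, algebraMap k F a ∈ V) → V ≠ A → f ∈ V) :
    ∃ g ∈ E, g ∉ A ∧
      ∀ V : ValuationSubring F, (∀ a : k, algebraMap k F a ∈ V) → V ≠ A → g ∈ V := by
  have hconj : ∀ z ∈ ((minpoly E f).map (algebraMap E F)).roots, ∃ σ : F ≃ₐ[E] F, σ f = z := by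
    intro z hz
    refine minpoly.exists_algEquiv_of_root' (Normal.isIntegral ‹_› f).isAlgebraic ?_
    have := Polynomial.isRoot_of_mem_roots hz
    rwa [Polynomial.IsRoot, Polynomial.eval_map_algebraMap] at this
  refine ⟨(((minpoly E f).map (algebraMap E F)).roots.prod), ?_, ?_, ?_⟩
  · have hcoeff := (Normal.splits ‹_› f : ((minpoly E f).map (algebraMap E F)).Splits
      ).coeff_zero_eq_prod_roots_of_monic ((minpoly.monic (Normal.isIntegral ‹_› f)).map _)
    rw [Polynomial.coeff_map] at hcoeff
    have h2 : ((minpoly E f).map (algebraMap E F)).roots.prod =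
        (-1) ^ ((minpoly E f).map (algebraMap E F)).natDegree *
          algebraMap E F ((minpoly E f).coeff 0) := by
      rw [hcoeff, ← mul_assoc, ← mul_pow]
      simp
    rw [h2]
    exact mul_mem (pow_mem (neg_mem (one_mem E)) _) (SetLike.coe_mem _)
  · have hroot : f ∈ ((minpoly E f).map (algebraMap E F)).roots := by
      rw [Polynomial.mem_roots (Polynomial.map_ne_zero (minpoly.ne_zero (Normal.isIntegral ‹_› f))),
        Polynomial.IsRoot, Polynomial.eval_map_algebraMap, minpoly.aeval]
    have hpoles : ∀ z ∈ ((minpoly E f).map (algebraMap E F)).roots, z ∉ A := by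
      intro z hz hzA
      obtain ⟨σ, rfl⟩ := hconj z hz
      rw [← hA σ] at hfA
      exact hfA hzA
    have key : ∀ m : Multiset F, (∀ z ∈ m, z ∉ A) → m ≠ 0 → m.prod ∉ A := by
      intro m
      induction m using Multiset.induction with
      | empty => simp
      | cons z m ih =>
        intro hm _
        rw [Multiset.prod_cons]
        rcases eq_or_ne m 0 with rfl | hm0
        · simpa using hm z (Multiset.mem_cons_self _ _)
        have h1 := ValuationSubring.one_lt_valuation_of_notMem (hm z (Multiset.mem_cons_self _ _))
        have h2 := ValuationSubring.one_lt_valuation_of_notMem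
          (ih (fun w hw => hm w (Multiset.mem_cons_of_mem hw)) hm0)
        rw [← A.valuation_le_one_iff, map_mul, not_le]
        exact one_lt_mul'' h1 h2
    exact key _ hpoles fun h0 => by simp [h0] at hroot
  · intro V hV hVA
    refine multiset_prod_mem _ fun z hz => ?_
    obtain ⟨σ, rfl⟩ := hconj z hz
    have hVσ : f ∈ V.comap (σ : F →+* F) := by
      refine hf _ (fun a => ?_) fun heq => hVA ?_
      · have hK : ∀ a : K, algebraMap K F a ∈ V := fun a => by
          rw [IsScalarTower.algebraMap_apply K k F]
          exact hV _
        refine ValuationSubring.mem_of_isIntegral_algebraMap hK (y := σ (algebraMap k F a)) ?_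
        have h_integral : IsIntegral K (algebraMap k F a) :=
          (Algebra.IsIntegral.isIntegral (R := K) a).algebraMap
        exact h_integral.map (σ.restrictScalars K)
      · ext z
        obtain ⟨w, rfl⟩ := σ.surjective z
        have : w ∈ V.comap (σ : F →+* F) ↔ w ∈ A.comap (σ : F →+* F) := by rw [heq, hA σ]
        exact this
    exact hVσ

end CurveAlgebra

section Evaluation

/-- An element of every valuation ring containing the image of `ρ` is integral over `ρ`. -/
lemma RingHom.isIntegralElem_of_forall_valuationSubring {R F : Type*} [CommRing R] [Field F]
    (ρ : R →+* F) {f : F} (h : ∀ V : ValuationSubring F, (∀ r, ρ r ∈ V) → f ∈ V) :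
    ρ.IsIntegralElem f := by
  let _ := ρ.toAlgebra
  by_contra hf
  have : IsIntegrallyClosedIn (integralClosure R F).toSubring F :=
    inferInstanceAs (IsIntegrallyClosedIn (integralClosure R F) F)
  obtain ⟨V, hV, hfV⟩ := Subring.exists_le_valuationSubring_of_isIntegrallyClosedIn
    (R := (integralClosure R F).toSubring) (x := f) hf
  exact hfV (h V fun r => hV ((integralClosure R F).algebraMap_mem r))

/-- A ring homomorphism from a domain `R` to a field extends to the fractions whose denominator does
not map to zero. -/
lemma exists_subring_lift_div {R F L : Type*} [CommRing R] [IsDomain R] [Field F] [Algebra R F]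
    [IsFractionRing R F] [Field L] (φ : R →+* L) :
    ∃ (T : Subring F) (ψ : T →+* L), ∀ a b : R, φ b ≠ 0 →
      ∃ h : algebraMap R F a / algebraMap R F b ∈ T, ψ ⟨_, h⟩ = φ a / φ b := by
  have hprime : (RingHom.ker φ).IsPrime := RingHom.ker_isPrime φ
  let M := (RingHom.ker φ).primeCompl
  have hM : M ≤ nonZeroDivisors R := Ideal.primeCompl_le_nonZeroDivisors _
  let T := Localization.subalgebra.ofField F M hM
  have : IsLocalization M T := Localization.subalgebra.isLocalization_ofField F M hM
  have hu : ∀ y : M, IsUnit (φ y) := fun y => isUnit_iff_ne_zero.mpr y.2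
  refine ⟨T.toSubring, (IsLocalization.lift hu : T →+* L), fun a b hb => ?_⟩
  have hbF : algebraMap R F b ≠ 0 := by
    intro h0
    rw [map_eq_zero_iff _ (IsFractionRing.injective R F)] at h0
    exact hb (by rw [h0, map_zero])
  have hmk : ((IsLocalization.mk' T a (⟨b, hb⟩ : M) : T) : F) =
      algebraMap R F a / algebraMap R F b := by
    rw [eq_div_iff hbF]
    exact congrArg (fun t : T => (t : F)) (IsLocalization.mk'_spec T a (⟨b, hb⟩ : M))
  refine ⟨hmk ▸ (IsLocalization.mk' T a (⟨b, hb⟩ : M)).2, ?_⟩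
  have : (⟨_, hmk ▸ (IsLocalization.mk' T a (⟨b, hb⟩ : M)).2⟩ : T) =
      IsLocalization.mk' T a (⟨b, hb⟩ : M) := Subtype.ext hmk.symm
  refine (congrArg (IsLocalization.lift hu : T →+* L) this).trans ?_
  rw [IsLocalization.lift_mk', Units.mul_inv_eq_iff_eq_mul]
  simp [IsUnit.coe_liftRight, div_mul_cancel₀ _ hb]

/-- A polynomial relation between fractions specializes along a ring homomorphism to a field. -/
lemma MvPolynomial.eval₂_div_eq_zero {σ R₀ R F L : Type*} [CommRing R₀] [CommRing R] [IsDomain R]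
    [Field F] [Algebra R F] [IsFractionRing R F] [Field L] (φ : R →+* L) (ρ : R₀ →+* R)
    (a b : σ → R) (hb : ∀ i, φ (b i) ≠ 0) {q : MvPolynomial σ R₀}
    (hq : q.eval₂ ((algebraMap R F).comp ρ)
      (fun i => algebraMap R F (a i) / algebraMap R F (b i)) = 0) :
    q.eval₂ (φ.comp ρ) (fun i => φ (a i) / φ (b i)) = 0 := by
  obtain ⟨T, ψ, hT⟩ := exists_subring_lift_div (F := F) φ
  choose h hψ using fun i => hT (a i) (b i) (hb i)
  have h1 : φ 1 ≠ 0 := by simp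
  choose m hm using fun r : R => hT r 1 h1
  simp only [map_one, div_one] at m hm
  let τ : R →+* T := (algebraMap R F).codRestrict T m
  have hτ : ψ.comp τ = φ := RingHom.ext fun r => hm r
  have hτ' : T.subtype.comp τ = algebraMap R F := RingHom.ext fun r => rfl
  have h0 : q.eval₂ (τ.comp ρ) (fun i => (⟨_, h i⟩ : T)) = 0 := by
    apply Subtype.val_injective
    have := MvPolynomial.hom_eval₂ q (τ.comp ρ) T.subtype (fun i => (⟨_, h i⟩ : T))
    rw [← RingHom.comp_assoc, hτ'] at this
    exact this.trans hq
  have := congrArg ψ h0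
  rw [MvPolynomial.hom_eval₂, ← RingHom.comp_assoc, hτ, map_zero] at this
  rw [← this]
  congr 1
  funext i
  exact (hψ i).symm

/-- An algebraic equation satisfied by a fraction specializes along a ring homomorphism to a
field. -/
lemma Polynomial.eval₂_div_eq_zero {R₀ R F L : Type*} [CommRing R₀] [CommRing R] [IsDomain R]
    [Field F] [Algebra R F] [IsFractionRing R F] [Field L] (φ : R →+* L) (ρ : R₀ →+* R)
    {a b : R} (hb : φ b ≠ 0) {p : Polynomial R₀}
    (hp : p.eval₂ ((algebraMap R F).comp ρ) (algebraMap R F a / algebraMap R F b) = 0) :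
    p.eval₂ (φ.comp ρ) (φ a / φ b) = 0 := by
  obtain ⟨T, ψ, hT⟩ := exists_subring_lift_div (F := F) φ
  obtain ⟨h, hψ⟩ := hT a b hb
  have h1 : φ 1 ≠ 0 := by simp
  choose m hm using fun r : R => hT r 1 h1
  simp only [map_one, div_one] at m hm
  let τ : R →+* T := (algebraMap R F).codRestrict T m
  have hτ : ψ.comp τ = φ := RingHom.ext fun r => hm r
  have hτ' : T.subtype.comp τ = algebraMap R F := RingHom.ext fun r => rfl
  have h0 : p.eval₂ (τ.comp ρ) (⟨_, h⟩ : T) = 0 := by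
    apply Subtype.val_injective
    have := Polynomial.hom_eval₂ p (τ.comp ρ) T.subtype (⟨_, h⟩ : T)
    rw [← RingHom.comp_assoc, hτ'] at this
    exact this.trans hp
  have := congrArg ψ h0
  rwa [Polynomial.hom_eval₂, ← RingHom.comp_assoc, hτ, map_zero, hψ] at this

/-- The roots of a monic polynomial, whose coefficients are polynomial functions over a number
field evaluated at integral points, have a uniformly bounded denominator. -/
lemma exists_ne_zero_isIntegral_mul {K ι : Type*} [Field K] [NumberField K]
    {p : Polynomial (MvPolynomial ι K)} (hp : p.Monic) :
    ∃ c : K, c ≠ 0 ∧ ∀ P : ι → K, (∀ i, IsIntegral ℤ (P i)) →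
      ∀ q : K, p.eval₂ (MvPolynomial.eval P) q = 0 → IsIntegral ℤ (c * q) := by
  classical
  obtain ⟨⟨c, hc⟩, hcoeff⟩ := IsLocalization.exist_integer_multiples_of_finset
    (nonZeroDivisors (𝓞 K)) (p.support.biUnion fun i => (p.coeff i).support.image (p.coeff i).coeff)
  refine ⟨algebraMap (𝓞 K) K c, by simpa using nonZeroDivisors.ne_zero hc, fun P hP q hq => ?_⟩
  have hO : ∀ z : K, IsIntegral ℤ z ↔ z ∈ (algebraMap (𝓞 K) K).range := fun z =>
    IsIntegralClosure.isIntegral_iff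
  have hval : ∀ i, algebraMap (𝓞 K) K c * MvPolynomial.eval P (p.coeff i) ∈
      (algebraMap (𝓞 K) K).range := by
    intro i
    rw [MvPolynomial.eval_eq, Finset.mul_sum]
    refine sum_mem fun m hm => ?_
    rw [← mul_assoc]
    refine mul_mem ?_ (prod_mem fun j _ => pow_mem ((hO _).mp (hP j)) _)
    have := hcoeff ((p.coeff i).coeff m)
      (Finset.mem_biUnion.mpr ⟨i, ?_, Finset.mem_image_of_mem _ hm⟩)
    · simpa [IsLocalization.IsInteger, Algebra.smul_def] using this
    · rw [Polynomial.mem_support_iff]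
      intro h0
      simp [h0] at hm
  have hlift : (Polynomial.C (algebraMap (𝓞 K) K c) * p.map (MvPolynomial.eval P)) ∈
      Polynomial.lifts (algebraMap (𝓞 K) K) := by
    rw [Polynomial.lifts_iff_coeff_lifts]
    intro i
    rw [Polynomial.coeff_C_mul, Polynomial.coeff_map]
    exact hval i
  obtain ⟨Q, hQ⟩ := (Polynomial.mem_lifts _).mp hlift
  have hlead : Q.leadingCoeff = c := by
    apply FaithfulSMul.algebraMap_injective (𝓞 K) K
    rw [← Polynomial.leadingCoeff_map_of_injective (FaithfulSMul.algebraMap_injective (𝓞 K) K), hQ,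
      Polynomial.leadingCoeff_mul, Polynomial.leadingCoeff_C, (hp.map _).leadingCoeff, mul_one]
  have hroot : Polynomial.aeval q Q = 0 := by
    rw [← Polynomial.eval_map_algebraMap, hQ, Polynomial.eval_mul, Polynomial.eval_map, hq,
      mul_zero]
  have := isIntegral_leadingCoeff_smul Q q hroot
  rw [hlead, Algebra.smul_def] at this
  exact isIntegral_trans _ this

end Evaluation

namespace AffineCurve

variable {K : Type} [Field K] {n : ℕ} (C : AffineCurve K n)

instance : Ring.KrullDimLE 1 C.CoordRing := Ring.krullDimLE_iff.mpr (by exact C.hdim.le)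

/-- The restriction to the curve of polynomial functions over `K`. -/
def restrict : MvPolynomial (Fin n) K →+* C.CoordRing :=
  (Ideal.Quotient.mk C.idealBar).comp (MvPolynomial.map (algebraMap K (AlgebraicClosure K)))

lemma algebraMap_restrict (h : MvPolynomial (Fin n) K) :
    algebraMap C.CoordRing C.FunField (C.restrict h) = MvPolynomial.aeval C.xcoord h := by
  have : (algebraMap C.CoordRing C.FunField).comp C.restrict =
      (MvPolynomial.aeval C.xcoord : MvPolynomial (Fin n) K →ₐ[K] C.FunField).toRingHom := by
    refine MvPolynomial.ringHom_ext (fun a => ?_) fun i => ?_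
    · simp only [restrict, RingHom.comp_apply, MvPolynomial.map_C, AlgHom.toRingHom_eq_coe,
        RingHom.coe_coe, MvPolynomial.algHom_C]
      rfl
    · simp [restrict, xcoord]
  exact congrArg (fun φ : MvPolynomial (Fin n) K →+* C.FunField => φ h) this

/-- Evaluation of regular functions at a `K`-rational point of the curve. -/
def evalAt {P : Fin n → K} (hP : C.OnCurve P) : C.CoordRing →ₐ[AlgebraicClosure K]
    AlgebraicClosure K :=
  Ideal.Quotient.liftₐ C.idealBar
    (MvPolynomial.aeval fun i => algebraMap K (AlgebraicClosure K) (P i)) <| by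
      have : C.idealBar ≤ RingHom.ker
          (MvPolynomial.aeval (R := AlgebraicClosure K)
            fun i => algebraMap K (AlgebraicClosure K) (P i)) := by
        refine Ideal.map_le_iff_le_comap.mpr fun h hh => ?_
        rw [Ideal.mem_comap, RingHom.mem_ker, MvPolynomial.aeval_map_algebraMap]
        refine (MvPolynomial.aeval_algebraMap_apply (AlgebraicClosure K) P h).trans ?_
        rw [MvPolynomial.aeval_eq_eval, hP h hh, map_zero]
      exact this

lemma evalAt_restrict {P : Fin n → K} (hP : C.OnCurve P) (h : MvPolynomial (Fin n) K) :
    C.evalAt hP (C.restrict h) = algebraMap K (AlgebraicClosure K) (MvPolynomial.eval P h) := by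
  change MvPolynomial.aeval (R := AlgebraicClosure K) _ (MvPolynomial.map _ h) = _
  rw [MvPolynomial.aeval_map_algebraMap]
  exact MvPolynomial.aeval_algebraMap_apply (AlgebraicClosure K) P h

/-- A nonzero regular function has finitely many `K`-rational zeros on the curve. -/
lemma finite_setOf_eval_eq_zero {h : MvPolynomial (Fin n) K} (hh : C.restrict h ≠ 0) :
    {P | C.OnCurve P ∧ MvPolynomial.eval P h = 0}.Finite := by
  rw [← Set.finite_coe_iff]
  have := (finite_setOf_isMaximal_mem hh).to_subtype
  refine Finite.of_injective (β := {M : Ideal C.CoordRing | M.IsMaximal ∧ C.restrict h ∈ M})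
    (fun P => ⟨RingHom.ker (C.evalAt P.2.1), ?_, ?_⟩) ?_
  · refine RingHom.ker_isMaximal_of_surjective (C.evalAt P.2.1) fun a =>
      ⟨algebraMap _ _ a, (C.evalAt P.2.1).commutes a⟩
  · rw [RingHom.mem_ker, evalAt_restrict, P.2.2, map_zero]
  · rintro ⟨P, hP, hP0⟩ ⟨Q, hQ, hQ0⟩ hPQ
    have hker : RingHom.ker (C.evalAt hP) = RingHom.ker (C.evalAt hQ) := congrArg Subtype.val hPQ
    refine Subtype.ext (funext fun i => ?_)
    have hmem : C.restrict (MvPolynomial.X i - MvPolynomial.C (P i)) ∈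
        RingHom.ker (C.evalAt hQ) := by
      rw [← hker, RingHom.mem_ker, evalAt_restrict]
      simp
    rw [RingHom.mem_ker, evalAt_restrict, map_eq_zero] at hmem
    simp only [map_sub, MvPolynomial.eval_X, MvPolynomial.eval_C] at hmem
    exact (sub_eq_zero.mp hmem).symm

/-- The function field `K(C)` of the curve over `K`, inside `K̄(C)`. -/
abbrev rationalSubfield : IntermediateField K C.FunField :=
  IntermediateField.adjoin K (Set.range C.xcoord)

lemma mem_subfield_of_algebraMap_mem_of_xcoord_mem (L : Subfield C.FunField)
    (h₁ : ∀ a : AlgebraicClosure K, algebraMap _ C.FunField a ∈ L)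
    (h₂ : ∀ i, C.xcoord i ∈ L) (z : C.FunField) : z ∈ L := by
  have hR : ∀ r : C.CoordRing, algebraMap C.CoordRing C.FunField r ∈ L := by
    intro r
    obtain ⟨r, rfl⟩ := Ideal.Quotient.mk_surjective r
    induction r using MvPolynomial.induction_on with
    | C a => exact h₁ a
    | add p q hp hq =>
      rw [map_add, map_add]
      exact add_mem hp hq
    | mul_X p i hp =>
      rw [map_mul, map_mul]
      exact mul_mem hp (h₂ i)
  obtain ⟨a, b, -, rfl⟩ := IsFractionRing.div_surjective C.CoordRing z
  exact div_mem (hR a) (hR b)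

instance : Normal C.rationalSubfield C.FunField := by
  have hconst : ∀ a : AlgebraicClosure K,
      IsIntegral C.rationalSubfield (algebraMap _ C.FunField a) ∧
        ((minpoly C.rationalSubfield (algebraMap _ C.FunField a)).map
          (algebraMap C.rationalSubfield C.FunField)).Splits := by
    intro a
    have h_integral : IsIntegral K a := Algebra.IsIntegral.isIntegral a
    have hintF : IsIntegral K (algebraMap _ C.FunField a) := h_integral.algebraMap
    refine ⟨hintF.tower_top, ?_⟩
    have hsplit : ((minpoly K a).map (algebraMap K C.FunField)).Splits := by
      rw [IsScalarTower.algebraMap_eq K (AlgebraicClosure K) C.FunField, ← Polynomial.map_map]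
      exact (IsAlgClosed.splits _).map _
    refine hsplit.of_dvd (Polynomial.map_ne_zero (minpoly.ne_zero h_integral)) ?_
    rw [IsScalarTower.algebraMap_eq K C.rationalSubfield C.FunField, ← Polynomial.map_map]
    refine Polynomial.map_dvd _ (minpoly.dvd _ _ ?_)
    rw [Polynomial.aeval_map_algebraMap, Polynomial.aeval_algebraMap_apply, minpoly.aeval, map_zero]
  refine normal_iff.mpr fun z => ?_
  have htop : z ∈ IntermediateField.adjoin C.rationalSubfield
      (Set.range (algebraMap (AlgebraicClosure K) C.FunField)) := by
    refine C.mem_subfield_of_algebraMap_mem_of_xcoord_mem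
      (IntermediateField.adjoin C.rationalSubfield
        (Set.range (algebraMap (AlgebraicClosure K) C.FunField))).toSubfield
      (fun a => IntermediateField.subset_adjoin _ _ (Set.mem_range_self a)) (fun i => ?_) z
    exact IntermediateField.algebraMap_mem (IntermediateField.adjoin C.rationalSubfield
      (Set.range (algebraMap (AlgebraicClosure K) C.FunField)))
      (⟨_, IntermediateField.subset_adjoin K _ ⟨i, rfl⟩⟩ : C.rationalSubfield)
  have halg := IntermediateField.isAlgebraic_adjoin (K := C.rationalSubfield)
    (S := Set.range (algebraMap (AlgebraicClosure K) C.FunField))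
    (by rintro _ ⟨a, rfl⟩; exact (hconst a).1)
  have hz : IsIntegral C.rationalSubfield z := by
    have h := halg.isAlgebraic ⟨z, htop⟩
    exact (isAlgebraic_iff_isIntegral.mp h).map
      (IntermediateField.val (IntermediateField.adjoin C.rationalSubfield _))
  refine ⟨hz, ?_⟩
  exact IntermediateField.splits_of_mem_adjoin _ _ (L := C.FunField)
    (by rintro _ ⟨a, rfl⟩; exact hconst a) htop

lemma fixesKC (σ : C.FunField ≃ₐ[C.rationalSubfield] C.FunField) : C.FixesKC σ.toRingEquiv := by
  refine ⟨fun a => ?_, fun i => ?_⟩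
  · exact σ.commutes (algebraMap K C.rationalSubfield a)
  · exact σ.commutes (⟨_, IntermediateField.subset_adjoin K _ ⟨i, rfl⟩⟩ : C.rationalSubfield)

lemma exists_eq_div_of_mem_rationalSubfield {f : C.FunField} (hf : f ∈ C.rationalSubfield)
    (hf0 : f ≠ 0) : ∃ r s : MvPolynomial (Fin n) K, C.restrict r ≠ 0 ∧ C.restrict s ≠ 0 ∧
      f = algebraMap C.CoordRing C.FunField (C.restrict r) /
        algebraMap C.CoordRing C.FunField (C.restrict s) := by
  obtain ⟨r, s, rfl⟩ := (IntermediateField.mem_adjoin_range_iff K C.xcoord f).mp hf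
  rw [← C.algebraMap_restrict, ← C.algebraMap_restrict] at hf0 ⊢
  refine ⟨r, s, fun h => hf0 (by simp [h]), fun h => hf0 (by simp [h]), rfl⟩

end AffineCurve

/-- A polynomial without constant term does not take the value `1` near the origin. -/
lemma MvPolynomial.exists_forall_norm_lt_eval₂_ne_one {σ k : Type*} [Finite σ] [Field k]
    (Φ : k →+* ℂ) {q : MvPolynomial σ k} (hq : MvPolynomial.constantCoeff q = 0) :
    ∃ δ > 0, ∀ z : σ → ℂ, (∀ i, ‖z i‖ < δ) → q.eval₂ Φ z ≠ 1 := by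
  have := Fintype.ofFinite σ
  have hcont : Continuous fun z : σ → ℂ => MvPolynomial.eval z (q.map Φ) :=
    MvPolynomial.continuous_eval _
  have h0 : MvPolynomial.eval (0 : σ → ℂ) (q.map Φ) ≠ 1 := by
    rw [MvPolynomial.eval_zero, MvPolynomial.constantCoeff_map, hq, map_zero]
    exact zero_ne_one
  obtain ⟨δ, hδ, hball⟩ := Metric.eventually_nhds_iff.mp (hcont.continuousAt.eventually_ne h0)
  refine ⟨δ, hδ, fun z hz => ?_⟩
  have := hball (y := z) (by rwa [dist_zero_right, pi_norm_lt_iff hδ])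
  rwa [MvPolynomial.eval_map] at this

namespace AffineCurve

/-- Over a field with a single archimedean place, a nonconstant function that is integral over the
coordinate functions takes bounded values at finitely many integral points. -/
lemma finite_setOf_norm_le {K : Type} [Field K] [NumberField K] [Subsingleton (InfinitePlace K)]
    {n : ℕ} (C : AffineCurve K n) {r s : MvPolynomial (Fin n) K} (hs : C.restrict s ≠ 0)
    (hconst : ∀ a : K, algebraMap C.CoordRing C.FunField (C.restrict r) /
      algebraMap C.CoordRing C.FunField (C.restrict s) ≠ algebraMap K C.FunField a)
    (h_integral : ((algebraMap C.CoordRing C.FunField).comp C.restrict).IsIntegralElem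
      (algebraMap C.CoordRing C.FunField (C.restrict r) /
        algebraMap C.CoordRing C.FunField (C.restrict s)))
    (φ : K →+* ℂ) (M : ℝ) :
    {P | C.OnCurve P ∧ (∀ i, IsIntegral ℤ (P i)) ∧ MvPolynomial.eval P s ≠ 0 ∧
      ‖φ (MvPolynomial.eval P r / MvPolynomial.eval P s)‖ ≤ M}.Finite := by
  obtain ⟨p, hp, hpf⟩ := h_integral
  obtain ⟨c, hc, hcint⟩ := exists_ne_zero_isIntegral_mul hp
  refine ((NumberField.Embeddings.finite_of_norm_le K ℂ (‖φ c‖ * M)).biUnion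
    (t := fun z => {P | C.OnCurve P ∧
      MvPolynomial.eval P (r - MvPolynomial.C (z / c) * s) = 0}) fun z _ => ?_).subset ?_
  · refine C.finite_setOf_eval_eq_zero fun h0 => hconst (z / c) ?_
    have hsF : algebraMap C.CoordRing C.FunField (C.restrict s) ≠ 0 := by
      rwa [Ne, map_eq_zero_iff _ (IsFractionRing.injective C.CoordRing C.FunField)]
    rw [div_eq_iff hsF]
    rw [map_sub, map_mul, sub_eq_zero] at h0
    rw [h0, map_mul, C.algebraMap_restrict (MvPolynomial.C _), MvPolynomial.algHom_C]
  · rintro P ⟨hP, hPint, hPs, hPM⟩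
    have hq : p.eval₂ (MvPolynomial.eval P)
        (MvPolynomial.eval P r / MvPolynomial.eval P s) = 0 := by
      have hcomp : ((C.evalAt hP : C.CoordRing →+* AlgebraicClosure K).comp C.restrict) =
          (algebraMap K (AlgebraicClosure K)).comp (MvPolynomial.eval P) :=
        RingHom.ext fun h => C.evalAt_restrict hP h
      have h0 := Polynomial.eval₂_div_eq_zero (C.evalAt hP : C.CoordRing →+* AlgebraicClosure K)
        C.restrict (by
          rw [RingHom.coe_coe, C.evalAt_restrict hP]
          simpa using hPs) hpf
      rw [hcomp, RingHom.coe_coe, C.evalAt_restrict hP, C.evalAt_restrict hP, ← map_div₀,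
        ← Polynomial.hom_eval₂, map_eq_zero] at h0
      exact h0
    refine Set.mem_biUnion (x := c * (MvPolynomial.eval P r / MvPolynomial.eval P s))
      ⟨hcint P hPint _ hq, fun φ' => ?_⟩ ⟨hP, ?_⟩
    · have hφ : ∀ x, ‖φ' x‖ = ‖φ x‖ := fun x => by
        rw [← InfinitePlace.apply, ← InfinitePlace.apply,
          Subsingleton.elim (InfinitePlace.mk φ') (InfinitePlace.mk φ)]
      rw [hφ, map_mul, norm_mul]
      gcongr
    · rw [mul_div_cancel_left₀ _ hc]
      simp [div_mul_cancel₀ _ hPs]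

variable {K : Type} [Field K] {n : ℕ} (C : AffineCurve K n)

lemma isAlgebraic_adjoin (x : C.FunField) (hx : Transcendental (AlgebraicClosure K) x) :
    Algebra.IsAlgebraic (Algebra.adjoin (AlgebraicClosure K) {x}) C.FunField :=
  isAlgebraic_adjoin_of_krullDimLE_one (R := C.CoordRing) hx

/-- If the curve has two points at infinity, one of which is defined over `K`, then there is a
function in `K(C)` whose only pole is that point. -/
lemma exists_mem_rationalSubfield_pole_only_at {A B : ValuationSubring C.FunField} (hAB : A ≠ B)
    (hinf : ∀ V, C.IsPointAtInfinity V ↔ V = A ∨ V = B) (hdefA : C.DefinedOverK A) :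
    ∃ f ∈ C.rationalSubfield, f ∉ A ∧ ∀ V : ValuationSubring C.FunField,
      (∀ a : AlgebraicClosure K, algebraMap _ C.FunField a ∈ V) → V ≠ A → f ∈ V := by
  obtain ⟨⟨hAK, hAtop⟩, i, hi⟩ := (hinf A).mpr (Or.inl rfl)
  obtain ⟨⟨hBK, -⟩, -⟩ := (hinf B).mpr (Or.inr rfl)
  obtain ⟨f, hfA, hf⟩ := exists_pole_only_at (k := AlgebraicClosure K) C.isAlgebraic_adjoin hAK
    (fun hBA => hAB (ValuationSubring.eq_of_le_of_isAlgebraic_adjoin (k := AlgebraicClosure K)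
      C.isAlgebraic_adjoin hBK hBA hAtop).symm) hi
    (fun V hV hxV => (hinf V).mp
      ⟨⟨hV, fun htop => hxV (htop ▸ ValuationSubring.mem_top _)⟩, i, hxV⟩)
  exact exists_pole_only_at_of_normal (K := K) (k := AlgebraicClosure K) C.rationalSubfield
    (fun σ => hdefA σ.toRingEquiv (C.fixesKC σ)) hfA hf

/-- A function regular at all places but one point at infinity is integral over the coordinate
functions. -/
lemma isIntegralElem_of_pole_only_at {A : ValuationSubring C.FunField} (hA : C.IsPointAtInfinity A)
    {f : C.FunField} (hf : ∀ V : ValuationSubring C.FunField,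
      (∀ a : AlgebraicClosure K, algebraMap _ C.FunField a ∈ V) → V ≠ A → f ∈ V) :
    ((algebraMap C.CoordRing C.FunField).comp C.restrict).IsIntegralElem f := by
  refine RingHom.isIntegralElem_of_forall_valuationSubring _ fun V hV => hf V (fun a => ?_) ?_
  · refine ValuationSubring.mem_of_isIntegral_algebraMap (R := K) (fun b => ?_)
      ((Algebra.IsIntegral.isIntegral (R := K) a).algebraMap)
    have := hV (MvPolynomial.C b)
    rwa [RingHom.comp_apply, C.algebraMap_restrict, MvPolynomial.algHom_C] at this
  · rintro rfl
    obtain ⟨-, i, hi⟩ := hA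
    have := hV (MvPolynomial.X i)
    rw [RingHom.comp_apply, C.algebraMap_restrict, MvPolynomial.aeval_X] at this
    exact hi this

/-- If a polynomial without constant term takes the value `1` at `(1 / f, 1 / g)`, then `f` and `g`
are not both large at a point of the curve. -/
lemma exists_norm_le_or_norm_le {f g : C.FunField} (φ : K →+* ℂ)
    {q : MvPolynomial (Fin 2) (AlgebraicClosure K)} (hq0 : MvPolynomial.constantCoeff q = 0)
    (hq : MvPolynomial.aeval ![f⁻¹, g⁻¹] q = 1) {r s t u : MvPolynomial (Fin n) K}
    (hf : f = algebraMap C.CoordRing C.FunField (C.restrict r) /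
      algebraMap C.CoordRing C.FunField (C.restrict s))
    (hg : g = algebraMap C.CoordRing C.FunField (C.restrict t) /
      algebraMap C.CoordRing C.FunField (C.restrict u)) :
    ∃ M : ℝ, ∀ P, C.OnCurve P → MvPolynomial.eval P r ≠ 0 → MvPolynomial.eval P t ≠ 0 →
      ‖φ (MvPolynomial.eval P r / MvPolynomial.eval P s)‖ ≤ M ∨
        ‖φ (MvPolynomial.eval P t / MvPolynomial.eval P u)‖ ≤ M := by
  obtain ⟨Φ, hΦ⟩ : ∃ Φ : AlgebraicClosure K →+* ℂ, Φ.comp (algebraMap K _) = φ := by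
    let _ := φ.toAlgebra
    exact ⟨(IsAlgClosed.lift : AlgebraicClosure K →ₐ[K] ℂ), AlgHom.comp_algebraMap _⟩
  obtain ⟨δ, hδ, hball⟩ := MvPolynomial.exists_forall_norm_lt_eval₂_ne_one Φ hq0
  refine ⟨δ⁻¹, fun P hP hr ht => ?_⟩
  by_contra! hlarge
  have hq1 : (q - 1).eval₂ ((algebraMap C.CoordRing C.FunField).comp
      (algebraMap (AlgebraicClosure K) C.CoordRing))
      (fun i => algebraMap C.CoordRing C.FunField (![C.restrict s, C.restrict u] i) /
        algebraMap C.CoordRing C.FunField (![C.restrict r, C.restrict t] i)) = 0 := by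
    rw [← IsScalarTower.algebraMap_eq, ← MvPolynomial.aeval_def, map_sub, map_one, sub_eq_zero,
      ← hq]
    congr 2
    funext i
    fin_cases i <;> simp [hf, hg]
  have hne : ∀ i, (C.evalAt hP : C.CoordRing →+* AlgebraicClosure K)
      (![C.restrict r, C.restrict t] i) ≠ 0 := by
    intro i
    fin_cases i <;> simpa [evalAt_restrict]
  have h0 := congrArg Φ (MvPolynomial.eval₂_div_eq_zero _ _ _ _ hne hq1)
  have hid : (C.evalAt hP : C.CoordRing →+* AlgebraicClosure K).comp
      (algebraMap (AlgebraicClosure K) C.CoordRing) = RingHom.id _ := (C.evalAt hP).comp_algebraMap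
  rw [hid, MvPolynomial.hom_eval₂, RingHom.comp_id, MvPolynomial.eval₂_sub, MvPolynomial.eval₂_one,
    map_zero, sub_eq_zero] at h0
  have hsmall : ∀ x y : K, δ⁻¹ < ‖φ (x / y)‖ → ‖φ (y / x)‖ < δ := by
    intro x y hxy
    rw [← inv_div, map_inv₀, norm_inv]
    exact inv_lt_of_inv_lt₀ hδ hxy
  refine hball _ (fun i => ?_) h0
  subst hΦ
  fin_cases i
  · simpa [evalAt_restrict] using hsmall _ _ hlarge.1
  · simpa [evalAt_restrict] using hsmall _ _ hlarge.2

end AffineCurve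

/-- If there is a single place in `S`, the `S`-integers are the algebraic integers. -/
lemma isIntegral_of_mem_SIntegers {K : Type} [Field K] [NumberField K] {S : Finset (NFPlace K)}
    (hS : ∀ v : NumberField.InfinitePlace K, Sum.inl v ∈ S) (hcard : S.card < 2) {x : K}
    (hx : x ∈ SIntegers K S) : IsIntegral ℤ x := by
  have hone : ∀ a ∈ S, ∀ b ∈ S, a = b := Finset.card_le_one.mp (by omega)
  obtain ⟨v₀⟩ : Nonempty (InfinitePlace K) := inferInstance
  refine IsIntegralClosure.isIntegral_iff.mpr
    (HeightOneSpectrum.mem_integers_of_valuation_le_one K x fun v => hx v fun hv => ?_)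
  exact Sum.inl_ne_inr (hone _ (hS v₀) _ hv)

/-- If `C` has exactly two points at infinity, both defined over `K`, and infinitely
many `S`-integral points, then `|S| ≥ 2`. -/
theorem two_le_card_of_infinite_SIntegralPoints
    (K : Type) [Field K] [NumberField K] (n : ℕ) (C : AffineCurve K n)
    (S : Finset (NFPlace K)) (hS : ∀ v : NumberField.InfinitePlace K, Sum.inl v ∈ S)
    (A B : ValuationSubring C.FunField) (hAB : A ≠ B)
    (hinf : ∀ V, C.IsPointAtInfinity V ↔ V = A ∨ V = B)
    (hdefA : C.DefinedOverK A) (hdefB : C.DefinedOverK B)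
    (hinfinite : (C.SIntegralPoints S).Infinite) :
    2 ≤ S.card := by
  by_contra! hcard
  have hsub : Subsingleton (InfinitePlace K) := ⟨fun v w => Sum.inl_injective
    (Finset.card_le_one.mp (by omega : S.card ≤ 1) _ (hS v) _ (hS w))⟩
  obtain ⟨v₀⟩ : Nonempty (InfinitePlace K) := inferInstance
  have hA := (hinf A).mpr (Or.inl rfl)
  have hB := (hinf B).mpr (Or.inr rfl)
  obtain ⟨f, hfE, hfA, hf⟩ := C.exists_mem_rationalSubfield_pole_only_at hAB hinf hdefA
  obtain ⟨g, hgE, hgB, hg⟩ := C.exists_mem_rationalSubfield_pole_only_at hAB.symm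
    (fun V => (hinf V).trans or_comm) hdefB
  have hf0 : f ≠ 0 := fun h => hfA (h ▸ zero_mem A)
  have hg0 : g ≠ 0 := fun h => hgB (h ▸ zero_mem B)
  have hfconst : ∀ a : K, f ≠ algebraMap K C.FunField a := fun a h =>
    hfA (h ▸ hA.1.1 (algebraMap K _ a))
  have hgconst : ∀ a : K, g ≠ algebraMap K C.FunField a := fun a h =>
    hgB (h ▸ hB.1.1 (algebraMap K _ a))
  have hfint := C.isIntegralElem_of_pole_only_at hA hf
  have hgint := C.isIntegralElem_of_pole_only_at hB hg
  obtain ⟨q, hq0, hq⟩ := exists_aeval_inv_eq_one (k := AlgebraicClosure K) (f := f) (g := g)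
    (fun V hV => (eq_or_ne V A).elim (fun h => Or.inr (hg V hV (h ▸ hAB)))
      fun h => Or.inl (hf V hV h)) hf0 hg0
  obtain ⟨r, s, hr, hs, hrs⟩ := C.exists_eq_div_of_mem_rationalSubfield hfE hf0
  obtain ⟨t, u, ht, hu, htu⟩ := C.exists_eq_div_of_mem_rationalSubfield hgE hg0
  obtain ⟨M, hM⟩ := C.exists_norm_le_or_norm_le v₀.embedding hq0 hq hrs htu
  rw [hrs] at hfconst hfint
  rw [htu] at hgconst hgint
  have hne : C.restrict (r * s * (t * u)) ≠ 0 := by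
    rw [map_mul, map_mul, map_mul]
    exact mul_ne_zero (mul_ne_zero hr hs) (mul_ne_zero ht hu)
  refine hinfinite (((C.finite_setOf_eval_eq_zero hne).union
    ((C.finite_setOf_norm_le hs hfconst hfint v₀.embedding M).union
      (C.finite_setOf_norm_le hu hgconst hgint v₀.embedding M))).subset ?_)
  rintro P ⟨hP, hPS⟩
  have hPint := fun i => isIntegral_of_mem_SIntegers hS hcard (hPS i)
  by_cases hP0 : MvPolynomial.eval P (r * s * (t * u)) = 0
  · exact Or.inl ⟨hP, hP0⟩
  simp only [map_mul, mul_eq_zero, not_or] at hP0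
  obtain ⟨⟨hPr, hPs⟩, hPt, hPu⟩ := hP0
  exact Or.inr ((hM P hP hPr hPt).imp (fun h => ⟨hP, hPint, hPs, h⟩) fun h => ⟨hP, hPint, hPu, h⟩)
end
end

section
/- Let C ⊂ 𝔸ⁿ be an affine algebraic curve defined over a number field K, S a finite set of places of K containing all infinite places, and O_S the ring of S-integers. Suppose C has genus 0, C has exactly one point at infinity, and C(O_S) contains a non-singular point. Then C(O_S) is infinite. -/
open IsDedekindDomain NumberField

set_option synthInstance.maxHeartbeats 1000000
set_option maxHeartbeats 2000000

noncomputable section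

variable (K : Type) [Field K] [NumberField K]

section RationalFunctionField

open Polynomial IntermediateField

/-- Over an algebraically closed field, a nonzero prime ideal of `k[X]` contains some `X - a`. -/
theorem Ideal.exists_X_sub_C_mem {k : Type*} [Field k] [IsAlgClosed k] (Q : Ideal k[X])
    [Q.IsPrime] (hQ : Q ≠ ⊥) : ∃ a, X - C a ∈ Q := by
  have hg := (Submodule.IsPrincipal.prime_generator_of_isPrime Q hQ).irreducible
  obtain ⟨a, ha⟩ := IsAlgClosed.exists_root _
    (IsAlgClosed.degree_eq_one_of_irreducible k hg ▸ one_ne_zero)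
  refine ⟨a, (Submodule.IsPrincipal.mem_iff_generator_dvd Q).2 ?_⟩
  exact (irreducible_X_sub_C a).dvd_symm hg (dvd_iff_isRoot.2 ha)

variable {k F : Type*} [Field k] [Field F] [Algebra k F]

theorem transcendental_of_adjoin_eq_top (hF : ¬ Algebra.IsAlgebraic k F) {t : F}
    (ht : k⟮t⟯ = ⊤) : Transcendental k t := by
  intro h
  have h1 : Algebra.IsAlgebraic k k⟮t⟯ := isAlgebraic_adjoin_simple h.isIntegral
  rw [ht] at h1
  exact hF (topEquiv.isAlgebraic_iff.1 h1)

/-- A transcendental generator `t` of `F` over `k` identifies `F` with the fraction field of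
`k[X]`. -/
theorem isFractionRing_aeval {t : F} (htr : Transcendental k t) (ht : k⟮t⟯ = ⊤) :
    @IsFractionRing k[X] _ F _ (aeval (R := k) t).toRingHom.toAlgebra := by
  let _ := (aeval (R := k) t).toRingHom.toAlgebra
  have hinj : Function.Injective (algebraMap k[X] F) := transcendental_iff_injective.1 htr
  have : FaithfulSMul k[X] F := (faithfulSMul_iff_algebraMap_injective _ _).2 hinj
  refine IsFractionRing.of_field k[X] F fun z => ?_
  obtain ⟨r, s, h⟩ := (mem_adjoin_simple_iff k z).1 (ht ▸ mem_top)
  exact ⟨r, s, h⟩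

theorem mem_range_aeval_of_isIntegral {t : F} (htr : Transcendental k t) (ht : k⟮t⟯ = ⊤) {y : F}
    (hy : (aeval (R := k) t).toRingHom.IsIntegralElem y) : ∃ g : k[X], aeval t g = y := by
  let _ := (aeval (R := k) t).toRingHom.toAlgebra
  have := isFractionRing_aeval htr ht
  exact (IsIntegrallyClosed.isIntegral_iff (R := k[X])).1 hy

/-- A rational function of `t` that is not a polynomial has a finite pole. -/
theorem exists_valuationSubring_pole [IsAlgClosed k] {t : F} (htr : Transcendental k t)
    (ht : k⟮t⟯ = ⊤) {x : F} (hx : x ∉ Set.range (aeval (R := k) t)) :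
    ∃ (a : k) (V : ValuationSubring F), (∀ c, algebraMap k F c ∈ V) ∧ x ∉ V ∧ t ∈ V ∧
      (t - algebraMap k F a)⁻¹ ∉ V := by
  let _ := (aeval (R := k) t).toRingHom.toAlgebra
  have := isFractionRing_aeval htr ht
  have hmap (p : k[X]) : algebraMap k[X] F p = aeval t p := rfl
  have : ∃ v : IsDedekindDomain.HeightOneSpectrum k[X], ¬ v.valuation F x ≤ 1 := by
    by_contra! h
    obtain ⟨p, hp⟩ := IsDedekindDomain.HeightOneSpectrum.mem_integers_of_valuation_le_one F x h
    exact hx ⟨p, hp⟩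
  obtain ⟨v, hv⟩ := this
  obtain ⟨a, ha⟩ := Ideal.exists_X_sub_C_mem v.asIdeal v.ne_bot
  have hle (p : k[X]) : v.valuation F (aeval t p) ≤ 1 := by
    rw [← hmap]; exact v.valuation_le_one p
  refine ⟨a, (v.valuation F).valuationSubring, fun c => ?_, hv, ?_, ?_⟩
  · simpa using hle (C c)
  · simpa using hle X
  · have h1 : v.valuation F (algebraMap k[X] F (X - C a)) < 1 :=
      (v.valuation_lt_one_iff_mem _).2 ha
    rw [hmap] at h1
    simp only [map_sub, aeval_X, aeval_C] at h1
    rw [Valuation.mem_valuationSubring_iff, map_inv₀, not_le]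
    refine (one_lt_inv₀ ?_).2 h1
    rw [Valuation.pos_iff]
    intro h0
    exact htr (sub_eq_zero.1 h0 ▸ isAlgebraic_algebraMap a)

/-- If at most one place of the rational function field `F` is a pole of some member of the
family `x`, then some generator `u` of `F` makes every `x i` a polynomial in `u`. -/
theorem exists_generator_forall_mem_range_aeval [IsAlgClosed k]
    (hF : ¬ Algebra.IsAlgebraic k F) {ι : Type*} (x : ι → F)
    (hx : ∀ V W : ValuationSubring F, (∀ c, algebraMap k F c ∈ V) → (∀ c, algebraMap k F c ∈ W) →
      (∃ i, x i ∉ V) → (∃ i, x i ∉ W) → V = W)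
    {t : F} (ht : k⟮t⟯ = ⊤) :
    ∃ u : F, k⟮u⟯ = ⊤ ∧ ∀ i, x i ∈ Set.range (aeval (R := k) u) := by
  by_cases h : ∀ i, x i ∈ Set.range (aeval (R := k) t)
  · exact ⟨t, ht, h⟩
  obtain ⟨i, hi⟩ := not_forall.1 h
  obtain ⟨a, V, hcV, hxV, -, huV⟩ :=
    exists_valuationSubring_pole (transcendental_of_adjoin_eq_top hF ht) ht hi
  have hu : k⟮(t - algebraMap k F a)⁻¹⟯ = ⊤ := by
    rw [eq_top_iff, ← ht, adjoin_simple_le_iff]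
    have h1 := inv_mem (mem_adjoin_simple_self k (t - algebraMap k F a)⁻¹)
    rw [inv_inv] at h1
    simpa using add_mem h1 (IntermediateField.algebraMap_mem k⟮(t - algebraMap k F a)⁻¹⟯ a)
  refine ⟨_, hu, fun j => ?_⟩
  by_contra hj
  obtain ⟨-, W, hcW, hxW, huW, -⟩ :=
    exists_valuationSubring_pole (transcendental_of_adjoin_eq_top hF hu) hu hj
  exact huV (hx V W hcV hcW ⟨i, hxV⟩ ⟨j, hxW⟩ ▸ huW)

end RationalFunctionField

section RegularPoint

/-- First-order Taylor expansion of a multivariate polynomial at a point. -/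
theorem MvPolynomial.sub_linearization_mem_sq {R σ : Type*} [CommRing R] [Fintype σ] (P : σ → R)
    (M : Ideal (MvPolynomial σ R)) (hM : ∀ i, X i - C (P i) ∈ M) (f : MvPolynomial σ R) :
    f - C (eval P f) - ∑ i, C (eval P (pderiv i f)) * (X i - C (P i)) ∈ M ^ 2 := by
  classical
  induction f using MvPolynomial.induction_on with
  | C a => simp
  | add p q hp hq =>
    convert add_mem hp hq using 1
    simp only [map_add, add_mul, Finset.sum_add_distrib]
    ring
  | mul_X p j hp =>
    have h2 : (∑ i, C (eval P (pderiv i p)) * (X i - C (P i))) * (X j - C (P j)) ∈ M ^ 2 := by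
      rw [pow_two]
      exact Ideal.mul_mem_mul (sum_mem fun i _ => M.mul_mem_left _ (hM i)) (hM j)
    convert add_mem (Ideal.mul_mem_right (X j) _ hp) h2 using 1
    have h3 : ∑ i, C (eval P (pderiv i (p * X j))) * (X i - C (P i)) =
        C (P j) * ∑ i, C (eval P (pderiv i p)) * (X i - C (P i)) +
          C (eval P p) * (X j - C (P j)) := by
      simp only [pderiv_mul, pderiv_X, map_add, map_mul, eval_X, add_mul, Finset.sum_add_distrib,
        Finset.mul_sum]
      congr 1
      · exact Finset.sum_congr rfl fun i _ => by ring
      · rw [Finset.sum_eq_single j]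
        · simp
        · intro i _ hij
          simp [hij.symm]
        · simp
    rw [h3]
    simp only [map_mul, eval_X]
    ring

variable {A F : Type*} [CommRing A] [IsNoetherianRing A]

theorem Localization.AtPrime.maximalIdeal_eq_span_of_le_sup_sq (m : Ideal A) [m.IsPrime] {s : A}
    (hs : s ∈ m) (hm : m ≤ Ideal.span {s} ⊔ m ^ 2) :
    IsLocalRing.maximalIdeal (Localization.AtPrime m) =
      Ideal.span {algebraMap A (Localization.AtPrime m) s} := by
  rw [← Localization.AtPrime.map_eq_maximalIdeal]
  refine le_antisymm ?_ ?_
  · refine Submodule.le_of_le_smul_of_le_jacobson_bot (I := m.map (algebraMap A _))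
      (IsNoetherian.noetherian _) ?_ ?_
    · rw [Localization.AtPrime.map_eq_maximalIdeal]
      exact IsLocalRing.maximalIdeal_le_jacobson _
    · have := Ideal.map_mono (f := algebraMap A (Localization.AtPrime m)) hm
      rw [Ideal.map_sup, Ideal.map_span, Set.image_singleton, Ideal.map_pow, pow_two] at this
      exact this
  · rw [Ideal.span_singleton_le_iff_mem]
    exact Ideal.mem_map_of_mem _ hs

theorem exists_notMem_mul_eq_mul_of_le_sup_sq [IsDomain A] (m : Ideal A) [m.IsPrime] {s : A}
    (hs : s ∈ m) (hm : m ≤ Ideal.span {s} ⊔ m ^ 2) {p : A} (hp : p ∈ m) :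
    ∃ q p', q ∉ m ∧ q * p = s * p' := by
  have h := Ideal.mem_map_of_mem (algebraMap A (Localization.AtPrime m)) hp
  rw [Localization.AtPrime.map_eq_maximalIdeal,
    Localization.AtPrime.maximalIdeal_eq_span_of_le_sup_sq m hs hm,
    Ideal.mem_span_singleton'] at h
  obtain ⟨y, hy⟩ := h
  obtain ⟨⟨b, q⟩, hb⟩ := IsLocalization.surj m.primeCompl y
  refine ⟨q, b, q.2, IsLocalization.injective (Localization.AtPrime m)
    m.primeCompl_le_nonZeroDivisors ?_⟩
  simp only at hb
  rw [map_mul, map_mul, ← hb, ← hy]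
  ring

theorem exists_notMem_mul_eq_of_isIntegral [IsDomain A] [Field F] [Algebra A F] [IsFractionRing A F]
    (m : Ideal A) [m.IsPrime] {s : A}
    (hs : s ∈ m) (hm : m ≤ Ideal.span {s} ⊔ m ^ 2) {y : F} (hy : IsIntegral A y) :
    ∃ q p, q ∉ m ∧ y * algebraMap A F q = algebraMap A F p := by
  let R := Localization.AtPrime m
  let _ : Algebra R F := IsLocalization.localizationAlgebraOfSubmonoidLe R F m.primeCompl
    (nonZeroDivisors A) m.primeCompl_le_nonZeroDivisors
  have : IsScalarTower A R F := IsLocalization.localization_isScalarTower_of_submonoid_le R F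
    m.primeCompl (nonZeroDivisors A) m.primeCompl_le_nonZeroDivisors
  have : IsFractionRing R F :=
    IsFractionRing.isFractionRing_of_isDomain_of_isLocalization m.primeCompl R F
  have : IsNoetherianRing R := IsLocalization.isNoetherianRing m.primeCompl R inferInstance
  have : IsDomain R := IsLocalization.isDomain_localization m.primeCompl_le_nonZeroDivisors
  have hprin : (IsLocalRing.maximalIdeal R).IsPrincipal :=
    ⟨_, Localization.AtPrime.maximalIdeal_eq_span_of_le_sup_sq m hs hm⟩
  have hdedekind : IsDedekindDomain R :=
    ((tfae_of_isNoetherianRing_of_isLocalRing_of_isDomain R).out 4 2).1 hprin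
  obtain ⟨z, hz⟩ := (IsIntegrallyClosed.isIntegral_iff (R := R)).1 (hy.tower_top (A := R))
  obtain ⟨⟨p, q⟩, hpq⟩ := IsLocalization.surj m.primeCompl z
  refine ⟨q, p, q.2, ?_⟩
  rw [← hz, IsScalarTower.algebraMap_apply A R F, IsScalarTower.algebraMap_apply A R F p,
    ← map_mul, hpq]

end RegularPoint

set_option linter.unusedSectionVars false

namespace AffineCurve

open Polynomial IntermediateField

variable {K} {n : ℕ} (C : AffineCurve K n)

/-- The coordinate functions, as elements of the coordinate ring. -/
def coord (i : Fin n) : C.CoordRing := Ideal.Quotient.mk C.idealBar (MvPolynomial.X i)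

theorem constMap_eq_algebraMap : C.constMap = algebraMap (AlgebraicClosure K) C.FunField := by
  ext a
  rw [IsScalarTower.algebraMap_apply (AlgebraicClosure K) C.CoordRing C.FunField]
  rfl

theorem exists_not_isIntegral_coord : ∃ i, ¬ IsIntegral (AlgebraicClosure K) (C.coord i) := by
  by_contra! h
  have hint : Algebra.IsIntegral (AlgebraicClosure K) C.CoordRing := by
    refine ⟨fun a => ?_⟩
    obtain ⟨p, rfl⟩ := Ideal.Quotient.mk_surjective a
    induction p using MvPolynomial.induction_on with
    | C a => exact isIntegral_algebraMap (A := C.CoordRing) (x := a)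
    | add p q hp hq => rw [map_add]; exact hp.add hq
    | mul_X p i hp => rw [map_mul]; exact hp.mul (h i)
  have hdim : ringKrullDim C.CoordRing = 1 := C.hdim
  rw [ringKrullDim_eq_zero_of_isField (isField_of_isIntegral_of_isField' (Field.toIsField
    (AlgebraicClosure K)))] at hdim
  exact zero_ne_one hdim

theorem not_isAlgebraic_funField : ¬ Algebra.IsAlgebraic (AlgebraicClosure K) C.FunField := by
  intro h
  obtain ⟨i, hi⟩ := C.exists_not_isIntegral_coord
  refine hi ((isIntegral_algebraMap_iff (IsFractionRing.injective C.CoordRing C.FunField)).1 ?_)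
  exact (h.isAlgebraic _).isIntegral

theorem exists_polynomial_parametrization (hgenus : C.GenusZero)
    (hinf : ∃! V : ValuationSubring C.FunField, C.IsPointAtInfinity V) :
    ∃ (t : C.FunField) (f : Fin n → (AlgebraicClosure K)[X]),
      (AlgebraicClosure K)⟮t⟯ = ⊤ ∧ ∀ i, aeval t (f i) = C.xcoord i := by
  obtain ⟨t, ht⟩ := hgenus
  have ht' : (AlgebraicClosure K)⟮t⟯ = ⊤ := by
    rw [← IntermediateField.toSubfield_inj, IntermediateField.adjoin_toSubfield,
      ← C.constMap_eq_algebraMap]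
    exact ht
  obtain ⟨u, hu, hx⟩ := exists_generator_forall_mem_range_aeval C.not_isAlgebraic_funField
    C.xcoord (fun V W hV hW hxV hxW => by
      rw [← C.constMap_eq_algebraMap] at hV hW
      refine hinf.unique ⟨⟨hV, ?_⟩, hxV⟩ ⟨⟨hW, ?_⟩, hxW⟩
      · rintro rfl; exact hxV.elim fun _ h => h trivial
      · rintro rfl; exact hxW.elim fun _ h => h trivial) ht'
  choose f hf using hx
  exact ⟨u, f, hu, hf⟩

/-- A polynomial parametrization of the curve induces an embedding of the coordinate ring into the
polynomial ring. -/
theorem exists_algHom_of_parametrization {t : C.FunField}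
    (ht : Transcendental (AlgebraicClosure K) t) {f : Fin n → (AlgebraicClosure K)[X]}
    (hf : ∀ i, aeval t (f i) = C.xcoord i) :
    ∃ ψ : C.CoordRing →ₐ[AlgebraicClosure K] (AlgebraicClosure K)[X],
      (∀ i, ψ (C.coord i) = f i) ∧ ∀ a, aeval t (ψ a) = algebraMap C.CoordRing C.FunField a := by
  have h : (aeval t).comp (MvPolynomial.aeval f) =
      (IsScalarTower.toAlgHom (AlgebraicClosure K) C.CoordRing C.FunField).comp
        (Ideal.Quotient.mkₐ (AlgebraicClosure K) C.idealBar) := by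
    refine MvPolynomial.algHom_ext fun i => ?_
    simpa [xcoord] using hf i
  have hle (p) (hp : p ∈ C.idealBar) : MvPolynomial.aeval f p = 0 := by
    apply transcendental_iff_injective.1 ht
    have := DFunLike.congr_fun h p
    simp only [AlgHom.comp_apply] at this
    rw [this, map_zero, Ideal.Quotient.mkₐ_eq_mk, Ideal.Quotient.eq_zero_iff_mem.2 hp, map_zero]
  refine ⟨Ideal.Quotient.liftₐ _ (MvPolynomial.aeval f) hle, fun i => ?_, fun a => ?_⟩
  · exact MvPolynomial.aeval_X f i
  · obtain ⟨p, rfl⟩ := Ideal.Quotient.mk_surjective a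
    exact DFunLike.congr_fun h p

theorem mk_map_eq_zero {f : MvPolynomial (Fin n) K} (hf : f ∈ C.J) :
    Ideal.Quotient.mk C.idealBar
      (MvPolynomial.map (algebraMap K (AlgebraicClosure K)) f) = 0 :=
  Ideal.Quotient.eq_zero_iff_mem.2 (Ideal.mem_map_of_mem _ hf)

/-- Evaluation of regular functions at a rational point of the curve. -/
theorem exists_evaluation {P : Fin n → K} (hP : C.OnCurve P) :
    ∃ ε : C.CoordRing →ₐ[AlgebraicClosure K] AlgebraicClosure K,
      ∀ i, ε (C.coord i) = algebraMap K (AlgebraicClosure K) (P i) := by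
  have hle : C.idealBar ≤ RingHom.ker (MvPolynomial.aeval (R := AlgebraicClosure K)
      fun i => algebraMap K (AlgebraicClosure K) (P i)) := by
    refine Ideal.map_le_iff_le_comap.2 fun f hf => ?_
    rw [Ideal.mem_comap, RingHom.mem_ker, MvPolynomial.aeval_map_algebraMap]
    have := congrArg (algebraMap K (AlgebraicClosure K)) (hP f hf)
    rw [map_zero] at this
    rw [← this, ← MvPolynomial.aeval_eq_eval]
    exact (MvPolynomial.aeval_algebraMap_apply (AlgebraicClosure K) P f)
  refine ⟨Ideal.Quotient.liftₐ _ (MvPolynomial.aeval _) hle, fun i => ?_⟩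
  exact MvPolynomial.aeval_X _ i

/-- At a nonsingular point, one of the translated coordinates generates the maximal ideal modulo
its square. -/
theorem exists_ker_le_span_sup_sq {P : Fin n → K} (hP : C.IsNonsingularPoint P)
    {ε : C.CoordRing →ₐ[AlgebraicClosure K] AlgebraicClosure K}
    (hε : ∀ i, ε (C.coord i) = algebraMap K (AlgebraicClosure K) (P i)) :
    ∃ j, RingHom.ker ε ≤
      Ideal.span {C.coord j - algebraMap K C.CoordRing (P j)} ⊔ RingHom.ker ε ^ 2 := by
  obtain ⟨hon, hrank⟩ := hP
  set m := RingHom.ker ε with hm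
  set W := Submodule.span K
    {g : Fin n → K | ∃ f ∈ C.J, g = fun i => MvPolynomial.eval P (MvPolynomial.pderiv i f)}
  have hKscalar (a : K) : algebraMap K C.CoordRing a =
      algebraMap (AlgebraicClosure K) C.CoordRing (algebraMap K (AlgebraicClosure K) a) :=
    IsScalarTower.algebraMap_apply K (AlgebraicClosure K) C.CoordRing a
  have hsmul (c : K) (y : C.CoordRing) : c • y = algebraMap K C.CoordRing c * y :=
    Algebra.smul_def c y
  have hmem (i) : C.coord i - algebraMap K C.CoordRing (P i) ∈ m := by
    rw [hm, RingHom.mem_ker, map_sub, hε, hKscalar, AlgHom.commutes]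
    exact sub_self _
  let L : (Fin n → K) →ₗ[K] C.CoordRing :=
    Fintype.linearCombination K fun i => C.coord i - algebraMap K C.CoordRing (P i)
  have hL (w : Fin n → K) :
      L w = ∑ i, w i • (C.coord i - algebraMap K C.CoordRing (P i)) := rfl
  have hWL : ∀ w ∈ W, L w ∈ m ^ 2 := by
    intro w hw
    have : W ≤ ((m ^ 2).restrictScalars K).comap L := by
      refine Submodule.span_le.2 ?_
      rintro _ ⟨f, hf, rfl⟩
      let q : MvPolynomial (Fin n) K →+* C.CoordRing :=
        (Ideal.Quotient.mk C.idealBar).comp (MvPolynomial.map (algebraMap K _))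
      have hqC (a : K) : q (MvPolynomial.C a) = algebraMap K C.CoordRing a := by
        rw [hKscalar]
        simp only [q, RingHom.comp_apply, MvPolynomial.map_C]
        rfl
      have hqX (i) : q (MvPolynomial.X i) = C.coord i := by simp [q, coord]
      have h := MvPolynomial.sub_linearization_mem_sq P (m.comap q)
        (fun i => by rw [Ideal.mem_comap, map_sub, hqC, hqX]; exact hmem i) f
      have h2 := (Ideal.map_pow q (m.comap q) 2).le (Ideal.mem_map_of_mem q h)
      have h3 := Ideal.pow_right_mono (Ideal.map_comap_le (f := q) (K := m)) 2 h2
      rw [hon f hf, map_zero, sub_zero, map_sub, show q f = 0 from C.mk_map_eq_zero hf, zero_sub,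
        neg_mem_iff, map_sum] at h3
      change L _ ∈ m ^ 2
      rw [hL]
      convert h3 using 2 with i
      rw [map_mul, hqC, map_sub, hqX, hqC, hsmul]
    exact this hw
  obtain ⟨i₀, -⟩ := C.exists_not_isIntegral_coord
  have hn : 0 < n := i₀.pos
  have hWtop : W ≠ ⊤ := by
    intro h
    rw [h, finrank_top, Module.finrank_fin_fun] at hrank
    omega
  obtain ⟨j, hj⟩ : ∃ j, Pi.single j (1 : K) ∉ W := by
    by_contra! h
    refine hWtop (eq_top_iff.2 ?_)
    rw [← (Pi.basisFun K (Fin n)).span_eq, Submodule.span_le]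
    rintro _ ⟨i, rfl⟩
    simpa using h i
  have hsup : W ⊔ Submodule.span K {Pi.single j (1 : K)} = ⊤ := by
    have hlt : W < W ⊔ Submodule.span K {Pi.single j (1 : K)} :=
      left_lt_sup.2 fun h => hj (h (Submodule.mem_span_singleton_self _))
    have h1 := Submodule.finrank_lt_finrank_of_lt hlt
    apply Submodule.eq_top_of_finrank_eq
    have h2 := Submodule.finrank_le (W ⊔ Submodule.span K {Pi.single j (1 : K)})
    rw [Module.finrank_fin_fun] at h2 ⊢
    omega
  have hLsingle (i) : L (Pi.single i 1) = C.coord i - algebraMap K C.CoordRing (P i) := by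
    simp [L]
  set I := Ideal.span {C.coord j - algebraMap K C.CoordRing (P j)} ⊔ m ^ 2 
  have hcoord (i) : C.coord i - algebraMap K C.CoordRing (P i) ∈ I := by
    have : Pi.single i (1 : K) ∈ W ⊔ Submodule.span K {Pi.single j (1 : K)} := hsup ▸ trivial
    obtain ⟨w, hw, c, hc, hwc⟩ := Submodule.mem_sup.1 this
    obtain ⟨d, rfl⟩ := Submodule.mem_span_singleton.1 hc
    rw [← hLsingle, ← hwc, map_add, map_smul, hLsingle, hsmul]
    refine add_mem (Ideal.mem_sup_right (hWL w hw)) (Ideal.mul_mem_left _ _ ?_)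
    exact Ideal.mem_sup_left (Ideal.mem_span_singleton_self _)
  refine ⟨j, fun a ha => ?_⟩
  obtain ⟨p, rfl⟩ := Ideal.Quotient.mk_surjective a
  let q := Ideal.Quotient.mk C.idealBar
  have hqC (a) : q (MvPolynomial.C a) = algebraMap (AlgebraicClosure K) C.CoordRing a := rfl
  have hqX (i) : q (MvPolynomial.X i) = C.coord i := rfl
  have h := MvPolynomial.sub_linearization_mem_sq (fun i => algebraMap K (AlgebraicClosure K) (P i))
    (m.comap q) (fun i => by
      rw [Ideal.mem_comap, map_sub, hqC, hqX, ← hKscalar]; exact hmem i) p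
  have h2 := (Ideal.map_pow q (m.comap q) 2).le (Ideal.mem_map_of_mem q h)
  have h3 := Ideal.pow_right_mono (Ideal.map_comap_le (f := q) (K := m)) 2 h2
  have heval : MvPolynomial.eval (fun i => algebraMap K (AlgebraicClosure K) (P i)) p = 0 := by
    have hcomp : ε.comp (Ideal.Quotient.mkₐ (AlgebraicClosure K) C.idealBar) =
        MvPolynomial.aeval fun i => algebraMap K (AlgebraicClosure K) (P i) :=
      MvPolynomial.algHom_ext fun i => by simpa [coord] using hε i
    rw [← MvPolynomial.aeval_eq_eval]
    exact (DFunLike.congr_fun hcomp p).symm.trans ha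
  rw [heval, map_zero, sub_zero, map_sub, map_sum] at h3
  have h4 : ∑ i, q (MvPolynomial.C (MvPolynomial.eval
      (fun i => algebraMap K (AlgebraicClosure K) (P i)) (MvPolynomial.pderiv i p)) *
        (MvPolynomial.X i - MvPolynomial.C (algebraMap K (AlgebraicClosure K) (P i)))) ∈ I := by
    refine sum_mem fun i _ => ?_
    rw [map_mul, map_sub, hqX, hqC (algebraMap K _ _), ← hKscalar]
    exact Ideal.mul_mem_left _ _ (hcoord i)
  simpa using add_mem (Ideal.mem_sup_right h3 : _ ∈ I) h4

end AffineCurve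

section Parametrization

open Polynomial

theorem AlgHom.isIntegral_of_natDegree_pos {k A : Type*} [Field k] [CommRing A] [Algebra k A]
    (ψ : A →ₐ[k] k[X]) {a : A} (ha : 0 < (ψ a).natDegree) : ψ.toRingHom.IsIntegral := by
  have hX : ψ.toRingHom.IsIntegralElem X := by
    have hne : ψ a ≠ 0 := by rintro h; simp [h] at ha
    have hmonic : (ψ a * C (ψ a).leadingCoeff⁻¹).Monic := monic_mul_leadingCoeff_inv hne
    have hdeg : 0 < (ψ a * C (ψ a).leadingCoeff⁻¹).degree := by
      rw [degree_mul_leadingCoeff_inv _ hne]; exact natDegree_pos_iff_degree_pos.1 ha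
    rcases subsingleton_or_nontrivial A with hA | hA
    · exact absurd (congrArg ψ (Subsingleton.elim (1 : A) 0)) (by simp)
    refine ⟨(ψ a * C (ψ a).leadingCoeff⁻¹).map (algebraMap k A) -
      C (a * algebraMap k A (ψ a).leadingCoeff⁻¹), ?_, ?_⟩
    · refine (hmonic.map _).sub_of_left (degree_C_le.trans_lt ?_)
      rwa [hmonic.degree_map]
    · have hcomp : ψ.toRingHom.comp (algebraMap k A) = C := ψ.comp_algebraMap
      rw [eval₂_sub, eval₂_map, hcomp, eval₂_C_X, eval₂_C]
      have hc (c : k) : ψ (algebraMap k A c) = C c := ψ.commutes c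
      simp [hc]
  have hC (c : k) : ψ.toRingHom.IsIntegralElem (C c) := by
    have h := ψ.toRingHom.isIntegralElem_map (x := algebraMap k A c)
    have hc : ψ.toRingHom (algebraMap k A c) = C c := ψ.commutes c
    rwa [hc] at h
  intro p
  induction p using Polynomial.induction_on with
  | C c => exact hC c
  | add p q hp hq => exact hp.add _ hq
  | monomial m c h =>
    rw [pow_succ, ← mul_assoc]
    exact h.mul _ hX

/-- Every maximal ideal with residue field `k` lifts to a point of the affine line along an
integral map to `k[X]`. -/
theorem AlgHom.exists_eval_eq_of_isIntegral {k A : Type*} [Field k] [IsAlgClosed k] [CommRing A]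
    [Algebra k A] (ψ : A →ₐ[k] k[X]) (hψ : ψ.toRingHom.IsIntegral)
    (hinj : Function.Injective ψ) (ε : A →ₐ[k] k) : ∃ b, ∀ a, (ψ a).eval b = ε a := by
  let _ := ψ.toRingHom.toAlgebra
  have hmap (a : A) : algebraMap A k[X] a = ψ a := rfl
  have : Algebra.IsIntegral A k[X] := ⟨hψ⟩
  have hmax : (RingHom.ker ε).IsMaximal :=
    RingHom.ker_isMaximal_of_surjective ε fun c => ⟨algebraMap k A c, ε.commutes c⟩
  obtain ⟨Q, hQ, hcomap⟩ := Ideal.exists_ideal_over_maximal_of_isIntegral (S := k[X])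
    (RingHom.ker ε) (by
      rw [(RingHom.injective_iff_ker_eq_bot (algebraMap A k[X])).1 hinj]
      exact bot_le)
  have hQ0 : Q ≠ ⊥ := Ring.ne_bot_of_isMaximal_of_not_isField hQ (Polynomial.not_isField k)
  obtain ⟨b, hb⟩ := Ideal.exists_X_sub_C_mem Q hQ0
  refine ⟨b, fun a => ?_⟩
  have h1 : ψ a - C (ε a) ∈ Q := by
    have : a - algebraMap k A (ε a) ∈ Ideal.comap (algebraMap A k[X]) Q := by
      rw [hcomap, RingHom.mem_ker, map_sub, ε.commutes]
      exact sub_self _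
    rw [Ideal.mem_comap, map_sub, hmap, hmap, ψ.commutes] at this
    exact this
  have h2 : ψ a - C ((ψ a).eval b) ∈ Q := Q.mem_of_dvd X_sub_C_dvd_sub_C_eval hb
  by_contra hne
  have h3 : C ((ψ a).eval b - ε a) ∈ Q := by
    convert sub_mem h1 h2 using 1
    rw [C_sub]; ring
  exact hQ.ne_top (Ideal.eq_top_of_isUnit_mem _ h3 (isUnit_C.2 (sub_ne_zero.2 hne).isUnit))

/-- If `f` and its conjugate `f.map σ` differ by a linear substitution `g` which maps the base
point `b` to its conjugate, and `c` is scaled compatibly, then the renormalization of `f`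
at `b` is invariant under `σ`. -/
theorem Polynomial.map_comp_normalization {k : Type*} [Field k] (σ : k →+* k) {f g : k[X]}
    (hg : g.natDegree = 1) (hfg : f = (f.map σ).comp g) {b c : k} (hb : g.eval b = σ b)
    (hc : c = g.coeff 1 * σ c) (hc0 : c ≠ 0) :
    (f.comp (C b + C c⁻¹ * X)).map σ = f.comp (C b + C c⁻¹ * X) := by
  have hg' : g = C (g.coeff 1) * X + C (g.coeff 0) := eq_X_add_C_of_natDegree_le_one hg.le
  have hsub : g.comp (C b + C c⁻¹ * X) = C (σ b) + C (σ c)⁻¹ * X := by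
    have hinv : g.coeff 1 * c⁻¹ = (σ c)⁻¹ := by
      have : σ c ≠ 0 := (_root_.map_ne_zero σ).2 hc0
      field_simp
      exact hc.symm
    have hb' : g.coeff 1 * b + g.coeff 0 = σ b := by
      rw [← hb]
      conv_rhs => rw [hg']
      simp
    rw [← hb', ← hinv]
    conv_lhs => rw [hg']
    simp only [add_comp, mul_comp, C_comp, X_comp, C_add, C_mul]
    ring
  conv_rhs => rw [hfg, comp_assoc, hsub]
  simp [Polynomial.map_comp]

end Parametrization

namespace AffineCurve

open Polynomial IntermediateField

variable {K} {n : ℕ} (C : AffineCurve K n)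

theorem algHom_ext {B : Type*} [CommRing B] [Algebra (AlgebraicClosure K) B]
    {φ ψ : C.CoordRing →ₐ[AlgebraicClosure K] B} (h : ∀ i, φ (C.coord i) = ψ (C.coord i)) :
    φ = ψ := by
  refine Ideal.Quotient.algHom_ext _ (MvPolynomial.algHom_ext fun i => ?_)
  exact h i

/-- The action of the Galois group of `K` on the function field. -/
theorem exists_ringEquiv_funField (σ : AlgebraicClosure K ≃ₐ[K] AlgebraicClosure K) :
    ∃ τ : C.FunField ≃+* C.FunField,
      (∀ c, τ (algebraMap _ _ c) = algebraMap (AlgebraicClosure K) C.FunField (σ c)) ∧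
      (∀ i, τ (C.xcoord i) = C.xcoord i) ∧ (∀ y, IsIntegral C.CoordRing y →
        IsIntegral C.CoordRing (τ y) ∧ IsIntegral C.CoordRing (τ.symm y)) := by
  let e := MvPolynomial.mapEquiv (Fin n) σ.toRingEquiv
  have he : C.idealBar = C.idealBar.map (e : _ →+* _) := by
    rw [idealBar, Ideal.map_map]
    congr 1
    refine MvPolynomial.ringHom_ext (fun a => ?_) fun i => ?_
    · simp [e]
    · simp [e]
  let α : C.CoordRing ≃+* C.CoordRing := Ideal.quotientEquiv C.idealBar C.idealBar e he
  have hα (p) : α (Ideal.Quotient.mk C.idealBar p) = Ideal.Quotient.mk C.idealBar (e p) := rfl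
  let τ : C.FunField ≃+* C.FunField := IsFractionRing.ringEquivOfRingEquiv α
  have hτ (a : C.CoordRing) : τ (algebraMap _ _ a) = algebraMap C.CoordRing C.FunField (α a) :=
    IsFractionRing.ringEquivOfRingEquiv_algebraMap α a
  refine ⟨τ, fun c => ?_, fun i => ?_, fun y hy => ⟨?_, ?_⟩⟩
  · rw [← C.constMap_eq_algebraMap]
    simp [constMap, hτ, hα, e]
  · simp [xcoord, hτ, hα, e]
  · exact hy.map_of_comp_eq α.toRingHom τ.toRingHom (RingHom.ext fun a => (hτ a).symm)
  · refine hy.map_of_comp_eq α.symm.toRingHom τ.symm.toRingHom (RingHom.ext fun a => ?_)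
    refine τ.injective ?_
    simp [hτ]

/-- Two conjugate polynomial parametrizations of the curve differ by a linear substitution. -/
theorem exists_linear_substitution {t : C.FunField}
    (htr : Transcendental (AlgebraicClosure K) t) (ht : (AlgebraicClosure K)⟮t⟯ = ⊤)
    {f : Fin n → (AlgebraicClosure K)[X]} (hf : ∀ i, aeval t (f i) = C.xcoord i)
    (hint : IsIntegral C.CoordRing t) (σ : AlgebraicClosure K ≃ₐ[K] AlgebraicClosure K) :
    ∃ g : (AlgebraicClosure K)[X], g.natDegree = 1 ∧
      ∀ i, f i = ((f i).map (σ : AlgebraicClosure K →+* AlgebraicClosure K)).comp g := by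
  obtain ⟨ψ, hψ, hψt⟩ := C.exists_algHom_of_parametrization htr hf
  obtain ⟨τ, hτc, hτx, hτint⟩ := C.exists_ringEquiv_funField σ
  have hpoly (y : C.FunField) (hy : IsIntegral C.CoordRing y) :
      ∃ g : (AlgebraicClosure K)[X], aeval t g = y := by
    refine mem_range_aeval_of_isIntegral htr ht ?_
    let _ := (aeval (R := AlgebraicClosure K) t).toRingHom.toAlgebra
    exact hy.map_of_comp_eq ψ.toRingHom (RingHom.id _) (RingHom.ext hψt)
  obtain ⟨g, hg⟩ := hpoly _ (hτint t hint).1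
  obtain ⟨h, hh⟩ := hpoly _ (hτint t hint).2
  have hτp (p : (AlgebraicClosure K)[X]) : τ (aeval t p) =
      aeval t ((p.map (σ : AlgebraicClosure K →+* AlgebraicClosure K)).comp g) := by
    rw [aeval_comp, hg, aeval_def, aeval_def, ← RingEquiv.coe_toRingHom τ, hom_eval₂, eval₂_map]
    congr 1
    ext c
    exact hτc c
  have hinj := transcendental_iff_injective.1 htr
  refine ⟨g, ?_, fun i => hinj ?_⟩
  · have hX : X = (h.map (σ : AlgebraicClosure K →+* AlgebraicClosure K)).comp g := by
      apply hinj
      rw [← hτp, hh, aeval_X, RingEquiv.apply_symm_apply]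
    have := congrArg natDegree hX
    rw [natDegree_X, natDegree_comp] at this
    exact Nat.eq_one_of_mul_eq_one_left this.symm
  · rw [← hτp, hf, hτx]

/-- A genus zero curve with one point at infinity and a nonsingular rational point `P` has a
polynomial parametrization over `K` sending `0` to `P`. -/
theorem exists_rational_parametrization (hgenus : C.GenusZero)
    (hinf : ∃! V : ValuationSubring C.FunField, C.IsPointAtInfinity V)
    {P : Fin n → K} (hP : C.IsNonsingularPoint P) :
    ∃ h : Fin n → K[X], (∀ i, (h i).eval 0 = P i) ∧ (∃ j, (h j).derivative.eval 0 ≠ 0) ∧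
      ∀ f ∈ C.J, MvPolynomial.aeval h f = 0 := by
  obtain ⟨t, f, ht, hf⟩ := C.exists_polynomial_parametrization hgenus hinf
  have htr := transcendental_of_adjoin_eq_top C.not_isAlgebraic_funField ht
  obtain ⟨ψ, hψ, hψt⟩ := C.exists_algHom_of_parametrization htr hf
  have hψinj : Function.Injective ψ := fun a b hab =>
    IsFractionRing.injective C.CoordRing C.FunField (by rw [← hψt, ← hψt, hab])
  have hψint : ψ.toRingHom.IsIntegral := by
    obtain ⟨i, hi⟩ := C.exists_not_isIntegral_coord
    refine ψ.isIntegral_of_natDegree_pos (a := C.coord i) (Nat.pos_of_ne_zero fun h0 => hi ?_)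
    have h1 : C.coord i = algebraMap (AlgebraicClosure K) C.CoordRing ((ψ (C.coord i)).coeff 0) := by
      refine hψinj ?_
      rw [ψ.commutes]
      exact eq_C_of_natDegree_eq_zero h0
    rw [h1]
    exact isIntegral_algebraMap
  have htint : IsIntegral C.CoordRing t := by
    let _ := ψ.toRingHom.toAlgebra
    have hX : IsIntegral C.CoordRing (X : (AlgebraicClosure K)[X]) := hψint X
    have := hX.map_of_comp_eq (RingHom.id _) (aeval t).toRingHom
      (RingHom.ext fun a => (hψt a).symm)
    simpa using this
  obtain ⟨ε, hε⟩ := C.exists_evaluation hP.1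
  obtain ⟨b, hb⟩ := ψ.exists_eval_eq_of_isIntegral hψint hψinj ε
  have hfb (i) : (f i).eval b = algebraMap K (AlgebraicClosure K) (P i) := by
    rw [← hψ, hb, hε]
  obtain ⟨j, hj⟩ := C.exists_ker_le_span_sup_sq hP hε
  have hKscalar (a : K) : algebraMap K C.CoordRing a =
      algebraMap (AlgebraicClosure K) C.CoordRing (algebraMap K (AlgebraicClosure K) a) :=
    IsScalarTower.algebraMap_apply K (AlgebraicClosure K) C.CoordRing a
  set s := C.coord j - algebraMap K C.CoordRing (P j) with hs
  have hsm : s ∈ RingHom.ker ε := by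
    rw [RingHom.mem_ker, hs, map_sub, hε, hKscalar, AlgHom.commutes]
    exact sub_self _
  have hprime : (RingHom.ker ε).IsPrime := RingHom.ker_isPrime ε
  -- The parameter `t - b` equals `s` up to a unit of the local ring at `P`.
  obtain ⟨u, v, hu, huv⟩ : ∃ u v : C.CoordRing, ε u ≠ 0 ∧ (X - Polynomial.C b) * ψ u = ψ s * ψ v := by
    obtain ⟨q, p, hq, hqp⟩ := exists_notMem_mul_eq_of_isIntegral (RingHom.ker ε) hsm hj
      (htint.sub (isIntegral_algebraMap (x := algebraMap (AlgebraicClosure K) C.CoordRing b)))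
    have hqp' : (X - Polynomial.C b) * ψ q = ψ p := by
      apply transcendental_iff_injective.1 htr
      rw [map_mul, hψt, hψt, ← hqp, map_sub, aeval_X, aeval_C,
        IsScalarTower.algebraMap_apply (AlgebraicClosure K) C.CoordRing C.FunField]
    have hp : p ∈ RingHom.ker ε := by
      rw [RingHom.mem_ker, ← hb, ← hqp']
      simp
    obtain ⟨q', p', hq', hqp''⟩ := exists_notMem_mul_eq_mul_of_le_sup_sq (RingHom.ker ε) hsm hj hp
    refine ⟨q' * q, p', ?_, ?_⟩
    · rw [map_mul]; exact mul_ne_zero hq' hq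
    · rw [← map_mul, ← hqp'', map_mul, map_mul, ← hqp']
      ring
  have hψs : ψ s = f j - Polynomial.C (algebraMap K (AlgebraicClosure K) (P j)) := by
    rw [hs, map_sub, hψ, hKscalar, AlgHom.commutes]
    rfl
  have hunique (d) (hd : ∀ i, (f i).eval d = algebraMap K (AlgebraicClosure K) (P i)) : d = b := by
    have hψd : (aeval d).comp ψ = ε := C.algHom_ext fun i => by
      rw [AlgHom.comp_apply, hψ, hε, coe_aeval_eq_eval, hd]
    have hud : (ψ u).eval d = ε u := by
      rw [← hψd, AlgHom.comp_apply, coe_aeval_eq_eval]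
    have := congrArg (eval d) huv
    rw [eval_mul, eval_mul, hud, hψs, eval_sub (p := f j), hd, eval_C, sub_self, zero_mul] at this
    simpa [hu, sub_eq_zero] using this
  set c := (f j).derivative.eval b with hc
  have hc0 : c ≠ 0 := by
    intro h0
    have := congrArg (fun p => eval b (derivative p)) huv
    simp only [hψs, derivative_mul, derivative_sub, derivative_X, derivative_C, sub_zero, one_mul,
      eval_add, eval_mul, eval_sub, eval_X, eval_C, sub_self, zero_mul, add_zero, hb, hfb,
      ← hc, h0] at this
    exact hu this
  let ℓ : (AlgebraicClosure K)[X] := Polynomial.C b + Polynomial.C c⁻¹ * X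
  have hinv (i) (σ : AlgebraicClosure K ≃ₐ[K] AlgebraicClosure K) :
      ((f i).comp ℓ).map (σ : AlgebraicClosure K →+* AlgebraicClosure K) = (f i).comp ℓ := by
    obtain ⟨g, hg1, hg⟩ := C.exists_linear_substitution htr ht hf htint σ
    have hgb : g.eval b = σ b := by
      have hd : σ.symm (g.eval b) = b := hunique _ fun i => by
        apply σ.injective
        have h1 := congrArg (eval b) (hg i)
        have h2 := eval_map_apply (σ : AlgebraicClosure K →+* AlgebraicClosure K)
          (p := f i) (σ.symm (g.eval b))
        rw [eval_comp, hfb] at h1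
        simp only [RingHom.coe_coe, AlgEquiv.apply_symm_apply] at h2
        rw [AlgEquiv.commutes, h1, h2]
      rw [← hd, AlgEquiv.apply_symm_apply, hd]
    refine Polynomial.map_comp_normalization _ hg1 (hg i) hgb ?_ hc0
    have h1 := congrArg (fun p => eval b (derivative p)) (hg j)
    have hg' : (derivative g).eval b = g.coeff 1 := by
      rw [eq_X_add_C_of_natDegree_le_one hg1.le]
      simp
    have h2 := eval_map_apply (σ : AlgebraicClosure K →+* AlgebraicClosure K)
      (p := derivative (f j)) b
    simp only [derivative_comp, eval_mul, eval_comp, hg', hgb, derivative_map, ← hc] at h1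
    exact h1.trans (congrArg _ h2)
  have hlift (i) : ∃ p : K[X], p.map (algebraMap K (AlgebraicClosure K)) = (f i).comp ℓ := by
    refine (mem_lifts _).1 ((lifts_iff_coeff_lifts _).2 fun m => ?_)
    refine IntermediateField.mem_bot.1 ((InfiniteGalois.mem_bot_iff_fixed _).2 fun σ => ?_)
    have := congrArg (fun p => coeff p m) (hinv i σ)
    simpa using this
  choose h hh using hlift
  have hinj := (algebraMap K (AlgebraicClosure K)).injective
  refine ⟨h, fun i => hinj ?_, ⟨j, fun h0 => ?_⟩, fun p hp => ?_⟩
  · rw [← hfb, ← eval_map_apply, hh]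
    simp [ℓ]
  · have h1 := congrArg (algebraMap K (AlgebraicClosure K)) h0
    rw [← eval_map_apply, ← derivative_map, hh] at h1
    simp [ℓ, derivative_comp, ← hc, hc0] at h1
  · apply map_injective _ hinj
    have h1 : ψ (Ideal.Quotient.mk C.idealBar (MvPolynomial.map (algebraMap K _) p)) = 0 := by
      rw [C.mk_map_eq_zero hp, map_zero]
    have h2 : (ψ.comp (Ideal.Quotient.mkₐ (AlgebraicClosure K) C.idealBar)) =
        MvPolynomial.aeval f := MvPolynomial.algHom_ext fun i => by
      simpa [coord] using hψ i
    have h3 : MvPolynomial.aeval f (MvPolynomial.map (algebraMap K (AlgebraicClosure K)) p) = 0 :=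
      (DFunLike.congr_fun h2 _).symm.trans h1
    have h4 : (mapRingHom (algebraMap K (AlgebraicClosure K))).comp
        (MvPolynomial.aeval h).toRingHom =
        ((compRingHom ℓ).comp (MvPolynomial.aeval f).toRingHom).comp
          (MvPolynomial.map (algebraMap K (AlgebraicClosure K))) := by
      refine MvPolynomial.ringHom_ext (fun a => ?_) fun i => ?_
      · simp
      · simp [hh]
    rw [Polynomial.map_zero]
    refine (RingHom.congr_fun h4 p).trans ?_
    simp [h3]

end AffineCurve

open Polynomial in
/-- A polynomial whose value at `0` lies in an overring of `R` takes values in that overring at all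
multiples of a suitable nonzero element of `R`. -/
theorem exists_forall_eval_mul_mem {R L ι : Type*} [CommRing R] [IsDomain R] [Field L]
    [Algebra R L] [IsFractionRing R L] [Fintype ι] (B : Subalgebra R L) (h : ι → L[X])
    (h0 : ∀ i, (h i).eval 0 ∈ B) :
    ∃ N : R, N ≠ 0 ∧ ∀ (m : R) (i : ι), (h i).eval (algebraMap R L (N * m)) ∈ B := by
  classical
  obtain ⟨N, hN⟩ := IsLocalization.exist_integer_multiples_of_finset (nonZeroDivisors R)
    (Finset.univ.biUnion fun i => (h i).coeffs)
  refine ⟨N, nonZeroDivisors.ne_zero N.2, fun m i => ?_⟩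
  rw [eval_eq_sum, Polynomial.sum]
  refine sum_mem fun e he => ?_
  rcases Nat.eq_zero_or_pos e with rfl | he0
  · simpa [coeff_zero_eq_eval_zero] using h0 i
  · obtain ⟨r, hr⟩ := hN ((h i).coeff e) (Finset.mem_biUnion.2
      ⟨i, Finset.mem_univ _, coeff_mem_coeffs (mem_support_iff.1 he)⟩)
    obtain ⟨e, rfl⟩ := Nat.exists_eq_succ_of_ne_zero he0.ne'
    rw [Algebra.smul_def] at hr
    have : (h i).coeff (e + 1) * algebraMap R L (N * m) ^ (e + 1) =
        algebraMap R L (r * m * (N * m) ^ e) := by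
      simp only [map_mul, map_pow, hr]
      ring
    rw [Nat.succ_eq_add_one, this]
    exact B.algebraMap_mem _

/-- If `C` has genus `0`, exactly one point at infinity, and a non-singular `S`-integral
point, then `C` has infinitely many `S`-integral points. -/
theorem infinite_SIntegralPoints_of_one_point_at_infinity
    (K : Type) [Field K] [NumberField K] (n : ℕ) (C : AffineCurve K n)
    (S : Finset (NFPlace K)) (hS : ∀ v : NumberField.InfinitePlace K, Sum.inl v ∈ S)
    (hgenus : C.GenusZero)
    (hinf : ∃! V : ValuationSubring C.FunField, C.IsPointAtInfinity V)
    (hP : ∃ P ∈ C.SIntegralPoints S, C.IsNonsingularPoint P) :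
    (C.SIntegralPoints S).Infinite := by
  obtain ⟨P, hPS, hPns⟩ := hP
  obtain ⟨h, hP0, ⟨j, hj⟩, hJ⟩ := C.exists_rational_parametrization hgenus hinf hPns
  obtain ⟨N, hN, hmem⟩ := exists_forall_eval_mul_mem (R := 𝓞 K) (SIntegers K S) h
    fun i => hP0 i ▸ hPS.2 i
  let z (m : ℕ) : K := algebraMap (𝓞 K) K (N * m)
  have hz : Function.Injective z := by
    intro a b hab
    have h1 : N * (a : 𝓞 K) = N * b := IsFractionRing.injective (𝓞 K) K hab
    exact_mod_cast mul_left_cancel₀ hN h1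
  have hpoint (m : ℕ) : (fun i => (h i).eval (z m)) ∈ C.SIntegralPoints S := by
    refine ⟨fun f hf => ?_, fun i => hmem m i⟩
    have h1 := congrArg (Polynomial.aeval (z m)) (hJ f hf)
    have h2 := MvPolynomial.comp_aeval_apply (f := h) (Polynomial.aeval (R := K) (z m)) f
    rw [h1, map_zero] at h2
    simpa [MvPolynomial.aeval_eq_eval, Polynomial.coe_aeval_eq_eval] using h2.symm
  intro hfin
  have := hfin.to_subtype
  obtain ⟨Q, hQ⟩ := Finite.exists_infinite_fiber
    fun m => (⟨_, hpoint m⟩ : C.SIntegralPoints S)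
  have hconst : h j = Polynomial.C (Q.1 j) := by
    refine Polynomial.eq_of_infinite_eval_eq _ _
      (((Set.infinite_coe_iff.1 hQ).image hz.injOn).mono ?_)
    rintro _ ⟨m, rfl, rfl⟩
    simp
  exact hj (by simp [hconst])
end
end
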